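/- Let $n\geq 3$ and let $Y_n\subset(\mathbb{P}^2)^n$ be the multiview variety of $n$ cameras in general position, with general affine charts chosen in each $\mathbb{P}^2$. Let $H_Q$ be the closure in $(\mathbb{P}^2)^n$ of the affine hypersurface $\{\sum_{i=1}^{2n}(z_i-\beta_i)^2 + \beta_0 = 0\}\subset\mathbb{C}^{2n}$ for a general $\bm\beta\in\mathbb{C}^{2n+1}$, and set $D_Q = Y_n\cap H_Q$, $D_\infty = Y_n\cap H_\infty$. Then $\chi(D_Q\cap D_\infty) = -\frac{n^3}{3} + \frac{13n}{3}$. -/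

import Mathlib

open scoped Manifold Topology
open Filter

noncomputable section

namespace PaperED

/-! Affine algebraic geometry over ℂ: algebraic subsets of ℂⁿ, genericity,
Zariski tangent spaces, smoothness, and the Euclidean distance degree. -/

/-- "P holds for a general point": P holds on a nonempty Zariski-open subset. -/
def Generically {K : Type} [CommSemiring K] {σ : Type} (P : (σ → K) → Prop) : Prop :=
  ∃ q : MvPolynomial σ K, q ≠ 0 ∧ ∀ a : σ → K, MvPolynomial.eval a q ≠ 0 → P a

/-- Affine algebraic subsets of ℂⁿ (common zero loci of polynomials). -/
def IsAlgSet {n : ℕ} (X : Set (Fin n → ℂ)) : Prop :=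
  ∃ S : Set (MvPolynomial (Fin n) ℂ),
    X = {x | ∀ p ∈ S, MvPolynomial.eval x p = 0}

/-- The differential of a polynomial at a point, as a linear functional. -/
def diffAt {n : ℕ} (p : MvPolynomial (Fin n) ℂ) (x : Fin n → ℂ) : (Fin n → ℂ) →ₗ[ℂ] ℂ :=
  ∑ i, MvPolynomial.eval x (MvPolynomial.pderiv i p) • LinearMap.proj i

/-- The Zariski tangent space of `X ⊆ ℂⁿ` at `x`. -/
def zTangent {n : ℕ} (X : Set (Fin n → ℂ)) (x : Fin n → ℂ) : Submodule ℂ (Fin n → ℂ) :=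
  ⨅ p ∈ {p : MvPolynomial (Fin n) ℂ | ∀ y ∈ X, MvPolynomial.eval y p = 0},
    LinearMap.ker (diffAt p x)

/-- `ψ` is a local holomorphic parametrization of `S` around `x`, with `d` parameters. -/
def IsParamAt {E : Type} [NormedAddCommGroup E] [NormedSpace ℂ E]
    (S : Set E) (x : E) (d : ℕ) (ψ : (Fin d → ℂ) → E) (U : Set (Fin d → ℂ)) : Prop :=
  IsOpen U ∧ (0 : Fin d → ℂ) ∈ U ∧ ψ 0 = x ∧ DifferentiableOn ℂ ψ U ∧
    Set.InjOn ψ U ∧ Function.Injective (fderiv ℂ ψ 0) ∧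
    ∃ V ∈ 𝓝 x, ψ '' U = S ∩ V

/-- `S` is, near `x`, a `d`-dimensional complex submanifold. -/
def IsSmoothGermAt {E : Type} [NormedAddCommGroup E] [NormedSpace ℂ E]
    (S : Set E) (x : E) (d : ℕ) : Prop :=
  ∃ ψ U, IsParamAt S x d ψ U

/-- `X` is a (nonempty) smooth closed subvariety of ℂⁿ of pure dimension `d`. -/
def IsSmoothClosedOfDim {n : ℕ} (X : Set (Fin n → ℂ)) (d : ℕ) : Prop :=
  IsAlgSet X ∧ X.Nonempty ∧
    ∀ x ∈ X, IsSmoothGermAt X x d ∧ Module.finrank ℂ ↥(zTangent X x) = d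

/-- Critical points of the squared distance function `f_α` on the locus of `X` where
the tangent space has dimension `d` (the smooth locus, when `dim X = d`):
the vector `x - α` is orthogonal to the tangent space w.r.t. `∑ zᵢwᵢ`. -/
def edCritSet {n : ℕ} (X : Set (Fin n → ℂ)) (d : ℕ) (α : Fin n → ℂ) : Set (Fin n → ℂ) :=
  {x | x ∈ X ∧ Module.finrank ℂ ↥(zTangent X x) = d ∧
    ∀ v ∈ zTangent X x, (∑ i, (x i - α i) * v i) = 0}

/-- The Euclidean distance degree of `X` (of dimension `d`) equals `k`: for a general
data point `α`, the squared distance function `f_α` has exactly `k` critical points on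
the smooth locus of `X`. -/
def HasEDDeg {n : ℕ} (X : Set (Fin n → ℂ)) (d : ℕ) (k : ℕ) : Prop :=
  Generically (K := ℂ) (σ := Fin n) fun α =>
    (edCritSet X d α).Finite ∧ (edCritSet X d α).ncard = k

/-- `U_β`: the complement in ℂⁿ of the hypersurface `∑ (zᵢ - βᵢ)² + β₀ = 0`. -/
def quadCompl {n : ℕ} (β : Fin (n + 1) → ℂ) : Set (Fin n → ℂ) :=
  {z | (∑ i : Fin n, (z i - β i.succ) ^ 2) + β 0 ≠ 0}

/-! Topological Euler characteristic, via homotopy equivalence with a space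
built from finitely many cells. -/

def cellSphere (d : ℕ) : Set (EuclideanSpace ℝ (Fin d)) := Metric.sphere 0 1
def cellBall (d : ℕ) : Set (EuclideanSpace ℝ (Fin d)) := Metric.closedBall 0 1

def attachRel {d : ℕ} {A : Type} [TopologicalSpace A] (φ : C(↥(cellSphere d), A)) :
    (A ⊕ ↥(cellBall d)) → (A ⊕ ↥(cellBall d)) → Prop := fun p q =>
  ∃ x : ↥(cellSphere d),
    p = Sum.inl (φ x) ∧ q = Sum.inr ⟨x.1, Metric.sphere_subset_closedBall x.2⟩

/-- The space obtained from `A` by attaching a `d`-cell along `φ`. -/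
def attachSp {d : ℕ} {A : Type} [TopologicalSpace A] (φ : C(↥(cellSphere d), A)) : Type :=
  Quot (attachRel φ)

instance {d : ℕ} {A : Type} [TopologicalSpace A] (φ : C(↥(cellSphere d), A)) :
    TopologicalSpace (attachSp φ) := inferInstanceAs (TopologicalSpace (Quot _))

/-- `B` is (homeomorphic to) the result of attaching one `d`-cell to `A`. -/
def AttachOneCell (A B : TopCat.{0}) (d : ℕ) : Prop :=
  ∃ φ : C(↥(cellSphere d), ↑A), Nonempty (↑B ≃ₜ attachSp φ)

/-- `Z` is obtained from `A` by attaching cells whose dimensions are listed in `L`. -/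
def AttachedCells : TopCat.{0} → TopCat.{0} → List ℕ → Prop
  | A, Z, [] => Nonempty (↑A ≃ₜ ↑Z)
  | A, Z, d :: L => ∃ B : TopCat.{0}, AttachOneCell A B d ∧ AttachedCells B Z L

/-- `X` has (topological) Euler characteristic `c`: `X` is homotopy equivalent to a
space built from finitely many cells, and `c` is the alternating sum of the
numbers of cells. -/
def HasEulerChar (X : Type) [TopologicalSpace X] (c : ℤ) : Prop :=
  ∃ (Z : TopCat.{0}) (L : List ℕ),
    AttachedCells (TopCat.of Empty) Z L ∧
    Nonempty (ContinuousMap.HomotopyEquiv X ↑Z) ∧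
    c = (L.map fun d => (-1 : ℤ) ^ d).sum

/-! The multiview variety of `n` cameras in `(ℙ²)ⁿ` and its affine chart. -/

abbrev P2 := Projectivization ℂ (Fin 3 → ℂ)

instance : TopologicalSpace P2 :=
  @instTopologicalSpaceQuotient _ (projectivizationSetoid ℂ (Fin 3 → ℂ)) _

/-- The point of ℙ² with homogeneous coordinate vector `v` (junk value if `v = 0`). -/
def mkP (v : Fin 3 → ℂ) : P2 :=
  if h : v ≠ 0 then Projectivization.mk ℂ v h
  else Projectivization.mk ℂ (fun _ => 1) (by
    intro h0; exact one_ne_zero (congrFun h0 0))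

/-- The tuple of cameras (3×4 matrices) with complex parameters `a`. -/
def camOfC {n : ℕ} (a : Fin n × Fin 3 × Fin 4 → ℂ) : Fin n → Matrix (Fin 3) (Fin 4) ℂ :=
  fun i => Matrix.of fun r c => a (i, r, c)

/-- The tuple of cameras with real parameters `a`, viewed as complex matrices. -/
def camOfR {n : ℕ} (a : Fin n × Fin 3 × Fin 4 → ℝ) : Fin n → Matrix (Fin 3) (Fin 4) ℂ :=
  fun i => Matrix.of fun r c => (a (i, r, c) : ℂ)

/-- The tuple of chart matrices (elements of GL₃ giving affine charts of ℙ²). -/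
def chartOf {n : ℕ} (cpar : Fin n × Fin 3 × Fin 3 → ℂ) : Fin n → Matrix (Fin 3) (Fin 3) ℂ :=
  fun i => Matrix.of fun r c => cpar (i, r, c)

/-- The image of the joint camera map `ℙ³ ⇢ (ℙ²)ⁿ` (on its locus of definition). -/
def mvImage {n : ℕ} (A : Fin n → Matrix (Fin 3) (Fin 4) ℂ) : Set (Fin n → P2) :=
  {P | ∃ y : Fin 4 → ℂ, y ≠ 0 ∧ (∀ i, (A i).mulVec y ≠ 0) ∧ ∀ i, P i = mkP ((A i).mulVec y)}

/-- The multiview variety `Yₙ ⊆ (ℙ²)ⁿ`: the closure of the image of the camera map. -/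
def mvVariety {n : ℕ} (A : Fin n → Matrix (Fin 3) (Fin 4) ℂ) : Set (Fin n → P2) :=
  closure (mvImage A)

def affLift (z : Fin 2 → ℂ) : Fin 3 → ℂ := Fin.cons 1 z

/-- The coordinate pair of the `i`-th factor, for `z ∈ ℂ²ⁿ`. -/
def camCoord (n : ℕ) (z : Fin (2 * n) → ℂ) (i : Fin n) : Fin 2 → ℂ :=
  fun k => z ⟨2 * i.1 + k.1, by have := i.2; have := k.2; omega⟩

/-- The affine chart `ℂ²ⁿ → (ℙ²)ⁿ` determined by the chart matrices `Cs`. -/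
def chartMapN {n : ℕ} (Cs : Fin n → Matrix (Fin 3) (Fin 3) ℂ) (z : Fin (2 * n) → ℂ) :
    Fin n → P2 :=
  fun i => mkP ((Cs i).mulVec <| affLift (camCoord n z i))

/-- The affine multiview variety `Xₙ = Yₙ ∩ ℂ²ⁿ ⊆ ℂ²ⁿ`, in the chart `Cs`. -/
def affineMV {n : ℕ} (A : Fin n → Matrix (Fin 3) (Fin 4) ℂ)
    (Cs : Fin n → Matrix (Fin 3) (Fin 3) ℂ) : Set (Fin (2 * n) → ℂ) :=
  chartMapN Cs ⁻¹' mvVariety A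

/-- The line at infinity of the affine chart of ℙ² given by the matrix `Cm`. -/
def infLine (Cm : Matrix (Fin 3) (Fin 3) ℂ) : Set P2 :=
  {p | ∃ w : Fin 3 → ℂ, w ≠ 0 ∧ w 0 = 0 ∧ p = mkP (Cm.mulVec w)}

/-- `D_{∞,i} = Yₙ ∩ H_{∞,i}`. -/
def Dinf {n : ℕ} (A : Fin n → Matrix (Fin 3) (Fin 4) ℂ)
    (Cs : Fin n → Matrix (Fin 3) (Fin 3) ℂ) (i : Fin n) : Set (Fin n → P2) :=
  mvVariety A ∩ {P | P i ∈ infLine (Cs i)}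

/-- `D_∞ = Yₙ ∩ H_∞`, the divisor at infinity. -/
def DinfAll {n : ℕ} (A : Fin n → Matrix (Fin 3) (Fin 4) ℂ)
    (Cs : Fin n → Matrix (Fin 3) (Fin 3) ℂ) : Set (Fin n → P2) :=
  mvVariety A ∩ ⋃ i, {P | P i ∈ infLine (Cs i)}

/-- The affine quadric hypersurface `∑ (zᵢ - βᵢ)² + β₀ = 0` in `ℂ²ⁿ`. -/
def quadSet (n : ℕ) (β : Fin (2 * n + 1) → ℂ) : Set (Fin (2 * n) → ℂ) :=
  {z | (∑ i : Fin (2 * n), (z i - β i.succ) ^ 2) + β 0 = 0}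

/-- `H_Q`: the closure in `(ℙ²)ⁿ` of the affine quadric hypersurface. -/
def HQ {n : ℕ} (Cs : Fin n → Matrix (Fin 3) (Fin 3) ℂ) (β : Fin (2 * n + 1) → ℂ) :
    Set (Fin n → P2) :=
  closure (chartMapN Cs '' quadSet n β)

/-- `D_Q = Yₙ ∩ H_Q`. -/
def DQ {n : ℕ} (A : Fin n → Matrix (Fin 3) (Fin 4) ℂ)
    (Cs : Fin n → Matrix (Fin 3) (Fin 3) ℂ) (β : Fin (2 * n + 1) → ℂ) :
    Set (Fin n → P2) :=
  mvVariety A ∩ HQ Cs β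

noncomputable section

open scoped Manifold Topology
open Filter

/-! ### Building cell structures on subsets of a Hausdorff space -/

theorem AttachedCells.snoc {Z B : TopCat.{0}} {d : ℕ} (hB : AttachOneCell Z B d) :
    ∀ {L : List ℕ} {A : TopCat.{0}}, AttachedCells A Z L → AttachedCells A B (L ++ [d]) := by
  intro L
  induction L with
  | nil =>
    rintro A ⟨e⟩
    obtain ⟨φ, ⟨f⟩⟩ := hB
    refine ⟨B, ⟨⟨fun x => e.symm (φ x), by fun_prop⟩, ⟨f.trans ?_⟩⟩, ⟨Homeomorph.refl _⟩⟩
    refine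
      { toFun := Quot.map (Sum.map e.symm id) ?_
        invFun := Quot.map (Sum.map e id) ?_
        left_inv := ?_
        right_inv := ?_
        continuous_toFun := ?_
        continuous_invFun := ?_ }
    · rintro _ _ ⟨x, rfl, rfl⟩
      exact ⟨x, rfl, rfl⟩
    · rintro _ _ ⟨x, rfl, rfl⟩
      exact ⟨x, by simp, rfl⟩
    · rintro ⟨x | x⟩ <;> simp [Quot.map] <;> rfl
    · rintro ⟨x | x⟩ <;> simp [Quot.map] <;> rfl
    · exact continuous_quot_lift _
        (continuous_quot_mk.comp (e.symm.continuous.sumMap continuous_id))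
    · exact continuous_quot_lift _
        (continuous_quot_mk.comp (e.continuous.sumMap continuous_id))
  | cons d' L ih =>
    rintro A ⟨C, hC, hL⟩
    exact ⟨C, hC, ih hL⟩

variable {M : Type} [TopologicalSpace M]

/-- The compact set `A` carries a finite cell structure whose alternating sum of cells is `c`. -/
def CellSet (A : Set M) (c : ℤ) : Prop :=
  IsCompact A ∧ ∃ L : List ℕ, AttachedCells (TopCat.of Empty) (TopCat.of A) L ∧
    c = (L.map fun d => (-1 : ℤ) ^ d).sum

theorem CellSet.hasEulerChar {A : Set M} {c : ℤ} (h : CellSet A c) : HasEulerChar A c := by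
  obtain ⟨-, L, hL, hc⟩ := h
  exact ⟨TopCat.of A, L, hL, ⟨ContinuousMap.HomotopyEquiv.refl _⟩, hc⟩

theorem CellSet.empty : CellSet (∅ : Set M) 0 :=
  ⟨isCompact_empty, [], ⟨Homeomorph.empty⟩, by simp⟩

instance (d : ℕ) : CompactSpace (cellBall d) :=
  isCompact_iff_compactSpace.mp (isCompact_closedBall 0 1)

instance {d : ℕ} {A : Type} [TopologicalSpace A] [CompactSpace A] (φ : C(cellSphere d, A)) :
    CompactSpace (attachSp φ) :=
  inferInstanceAs (CompactSpace (Quot _))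

theorem CellSet.attach [T2Space M] {A : Set M} {c : ℤ} (hA : CellSet A c) (d : ℕ)
    (Φ : EuclideanSpace ℝ (Fin d) → M) (hΦ : ContinuousOn Φ (cellBall d))
    (hs : ∀ x, ‖x‖ = 1 → Φ x ∈ A) (hb : ∀ x, ‖x‖ < 1 → Φ x ∉ A)
    (hinj : ∀ x y, ‖x‖ < 1 → ‖y‖ < 1 → Φ x = Φ y → x = y) :
    CellSet (A ∪ Φ '' cellBall d) (c + (-1) ^ d) := by
  obtain ⟨hAc, L, hL, hc⟩ := hA
  have hBc : IsCompact (A ∪ Φ '' cellBall d) :=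
    hAc.union ((isCompact_closedBall (0 : EuclideanSpace ℝ (Fin d)) 1).image_of_continuousOn hΦ)
  refine ⟨hBc, L ++ [d], hL.snoc ?_, by simp [hc]⟩
  have hsub : ∀ x : cellSphere d, x.1 ∈ cellBall d := fun x => Metric.sphere_subset_closedBall x.2
  have hsn : ∀ x : cellSphere d, ‖x.1‖ = 1 := fun x => by simpa [cellSphere] using x.2
  have hbn : ∀ x : cellBall d, ‖x.1‖ ≤ 1 := fun x => by simpa [cellBall] using x.2
  have hΦ' : Continuous fun x : cellBall d => Φ x := continuousOn_iff_continuous_domRestrict.mp hΦ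
  let φ : C(cellSphere d, A) := ⟨fun x => ⟨Φ x, hs _ (hsn x)⟩,
    Continuous.subtype_mk (hΦ'.comp (Continuous.subtype_mk continuous_subtype_val hsub)) _⟩
  refine ⟨φ, ⟨Homeomorph.symm ?_⟩⟩
  let g : A ⊕ cellBall d → ↥(A ∪ Φ '' cellBall d) :=
    Sum.elim (fun a => ⟨a, Or.inl a.2⟩) (fun x => ⟨Φ x, Or.inr ⟨x, x.2, rfl⟩⟩)
  have hg : Continuous g :=
    continuous_sumElim.mpr ⟨by fun_prop, Continuous.subtype_mk hΦ' _⟩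
  let G : attachSp φ → ↥(A ∪ Φ '' cellBall d) := Quot.lift g (by
    rintro _ _ ⟨x, rfl, rfl⟩; rfl)
  have hG : Continuous G := continuous_quot_lift _ hg
  have hmix : ∀ (a : A) (x : cellBall d), a.1 = Φ x →
      (Quot.mk (attachRel φ) (Sum.inl a)) = Quot.mk _ (Sum.inr x) := by
    intro a x h
    have h1 : ‖x.1‖ = 1 := by
      refine le_antisymm (hbn x) (not_lt.mp fun hlt => hb _ hlt (h ▸ a.2))
    exact Quot.sound ⟨⟨x.1, by simpa [cellSphere] using h1⟩, by
      congr 1; exact Subtype.ext h, rfl⟩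
  have hGbij : Function.Bijective G := by
    constructor
    · rintro ⟨a | x⟩ ⟨b | y⟩ h
      · have : a.1 = b.1 := congrArg (fun t : ↥(A ∪ Φ '' cellBall d) => t.1) h
        rw [Subtype.ext this]
      · exact hmix a y (congrArg (fun t : ↥(A ∪ Φ '' cellBall d) => t.1) h)
      · exact (hmix b x (congrArg (fun t : ↥(A ∪ Φ '' cellBall d) => t.1) h).symm).symm
      · have h : Φ x = Φ y := congrArg (fun t : ↥(A ∪ Φ '' cellBall d) => t.1) h
        by_cases hx : ‖x.1‖ = 1
        · exact (hmix ⟨Φ x, hs _ hx⟩ x rfl).symm.trans (hmix ⟨Φ x, hs _ hx⟩ y h)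
        by_cases hy : ‖y.1‖ = 1
        · exact (hmix ⟨Φ y, hs _ hy⟩ x h.symm).symm.trans (hmix ⟨Φ y, hs _ hy⟩ y rfl)
        rw [Subtype.ext (hinj _ _ ((hbn x).lt_of_ne hx) ((hbn y).lt_of_ne hy) h)]
    · rintro ⟨p, hp | ⟨x, hx, rfl⟩⟩
      · exact ⟨Quot.mk _ (Sum.inl ⟨p, hp⟩), rfl⟩
      · exact ⟨Quot.mk _ (Sum.inr ⟨x, hx⟩), rfl⟩
  haveI : CompactSpace A := isCompact_iff_compactSpace.mp hAc
  exact Continuous.homeoOfEquivCompactToT2 (f := Equiv.ofBijective G hGbij) hG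

theorem CellSet.insert_point [T2Space M] {A : Set M} {c : ℤ} (hA : CellSet A c) {p : M}
    (hp : p ∉ A) : CellSet (A ∪ {p}) (c + 1) := by
  have := hA.attach 0 (fun _ => p) continuousOn_const (fun x hx => by simp [Subsingleton.elim x 0] at hx)
    (fun _ _ => hp) (fun x y _ _ _ => Subsingleton.elim x y)
  have hne : (cellBall 0).Nonempty := ⟨0, by simp [cellBall]⟩
  simpa [hne.image_const] using this

theorem CellSet.attach_arc [T2Space M] {A : Set M} {c : ℤ} (hA : CellSet A c) {f : ℝ → M}
    (hf : Continuous f) {a b : ℝ} (hab : a < b) (ha : f a ∈ A) (hb : f b ∈ A)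
    (hinj : Set.InjOn f (Set.Ioo a b)) (hd : ∀ x ∈ Set.Ioo a b, f x ∉ A) :
    CellSet (A ∪ f '' Set.Icc a b) (c - 1) := by
  let s : EuclideanSpace ℝ (Fin 1) → ℝ := fun x => (a + b) / 2 + (b - a) / 2 * x 0
  have hn : ∀ x : EuclideanSpace ℝ (Fin 1), ‖x‖ = |x 0| := fun x => by
    simp [EuclideanSpace.norm_eq, Real.sqrt_sq_eq_abs]
  have hs : Continuous s := by fun_prop
  have hIoo : ∀ x, ‖x‖ < 1 → s x ∈ Set.Ioo a b := by
    intro x hx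
    rw [hn, abs_lt] at hx
    constructor <;> simp only [s] <;> nlinarith
  have := hA.attach 1 (fun x => f (s x)) (hf.comp hs).continuousOn ?_
    (fun x hx => hd _ (hIoo x hx)) ?_
  · convert this using 1
    swap
    · simp [sub_eq_add_neg]
    rw [← Set.image_image f s]
    suffices h : s '' cellBall 1 = Set.Icc a b by rw [h]
    ext y
    rw [Set.mem_image]
    constructor
    · rintro ⟨x, hx, rfl⟩
      simp only [cellBall, mem_closedBall_zero_iff, hn, abs_le] at hx
      constructor <;> simp only [s] <;> nlinarith
    · rintro ⟨h1, h2⟩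
      have hba : 0 < b - a := sub_pos.mpr hab
      refine ⟨WithLp.toLp 2 fun _ : Fin 1 => (2 * y - (a + b)) / (b - a), ?_, ?_⟩
      · simp only [cellBall, mem_closedBall_zero_iff, hn]
        rw [abs_le, le_div_iff₀ hba, div_le_iff₀ hba]
        constructor <;> linarith
      · simp only [s]; field_simp; ring
  · intro x hx
    rw [hn] at hx
    rcases eq_or_eq_neg_of_abs_eq hx with h | h
    · have : s x = b := by simp only [s, h]; ring
      simpa [this] using hb
    · have : s x = a := by simp only [s, h]; ring
      simpa [this] using ha
  · intro x y hx hy h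
    have h := hinj (hIoo x hx) (hIoo y hy) h
    have hba : (b - a) / 2 ≠ 0 := by linarith
    ext i
    fin_cases i
    simpa [s, hba, sub_ne_zero.mpr hab.ne'] using h

end

noncomputable section

open scoped Manifold Topology
open Filter

theorem exists_homeomorph_im_eq_zero (E : Finset ℂ) : ∃ φ : ℂ ≃ₜ ℂ, ∀ e ∈ E, (φ e).im = 0 := by
  obtain ⟨t, ht⟩ := Set.Infinite.exists_notMem_finset (s := (Set.univ : Set ℝ)) Set.infinite_univ
    ((E ×ˢ E).image fun p => (p.1.re - p.2.re) / (p.1.im - p.2.im))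
  have hinj : Set.InjOn (fun z : ℂ => z.re - t * z.im) E := by
    intro z hz w hw h
    by_contra hne
    simp only at h
    have him : z.im - w.im ≠ 0 := by
      intro h0
      refine hne (Complex.ext ?_ (sub_eq_zero.mp h0))
      have : z.im = w.im := sub_eq_zero.mp h0
      rw [this] at h; linarith
    refine ht.2 (Finset.mem_image.mpr ⟨(z, w), Finset.mem_product.mpr ⟨hz, hw⟩, ?_⟩)
    rw [div_eq_iff him]; linarith
  let q := Lagrange.interpolate E (fun z : ℂ => z.re - t * z.im) fun z => z.im
  have hq : ∀ e ∈ E, q.eval (e.re - t * e.im) = e.im := fun e he =>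
    Lagrange.eval_interpolate_at_node (fun z : ℂ => z.im) hinj he
  have hqc : Continuous fun x => q.eval x := q.continuous
  refine ⟨{ toFun := fun z => ((z.re - t * z.im : ℝ) : ℂ) +
              ((z.im - q.eval (z.re - t * z.im) : ℝ) : ℂ) * Complex.I
            invFun := fun w => ((w.re + t * (w.im + q.eval w.re) : ℝ) : ℂ) +
              ((w.im + q.eval w.re : ℝ) : ℂ) * Complex.I
            left_inv := fun z => ?_
            right_inv := fun w => ?_
            continuous_toFun := by fun_prop
            continuous_invFun := by fun_prop }, fun e he => ?_⟩
  · apply Complex.ext <;> simp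
  · apply Complex.ext <;> simp
  · simp [hq e he]

/-- The map from the closed unit disc to the Riemann sphere that is a bijection from the open disc
onto the complement of the segment `[a, b]` and folds the boundary circle onto that segment. -/
def joukowski (a b : ℝ) (w : ℂ) : OnePoint ℂ :=
  if w = 0 then OnePoint.infty
  else ((((a + b) / 2 : ℝ) : ℂ) + ((b - a) / 2 : ℝ) * ((w + w⁻¹) / 2) : ℂ)

theorem continuous_joukowski {a b : ℝ} (hab : a < b) : Continuous (joukowski a b) := by
  rw [continuous_iff_continuousAt]
  intro w
  by_cases hw : w = 0
  · subst hw
    rw [continuousAt_iff_punctured_nhds]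
    have h1 : Tendsto (fun w : ℂ => (((a + b) / 2 : ℝ) : ℂ) + ((b - a) / 2 : ℝ) * ((w + w⁻¹) / 2))
        (𝓝[≠] 0) (coclosedCompact ℂ) := by
      rw [coclosedCompact_eq_cocompact, ← Metric.cobounded_eq_cocompact,
        ← tendsto_norm_atTop_iff_cobounded]
      have h2 : Tendsto (fun w : ℂ => (b - a) / 4 * (‖w⁻¹‖ - 1) - ‖(((a + b) / 2 : ℝ) : ℂ)‖)
          (𝓝[≠] 0) atTop := by
        refine tendsto_atTop_add_const_right _ _ (Tendsto.const_mul_atTop (by linarith) ?_)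
        exact tendsto_atTop_add_const_right _ _
          (tendsto_norm_cobounded_atTop.comp tendsto_inv₀_nhdsNE_zero)
      refine tendsto_atTop_mono' _ ?_ h2
      have : ∀ᶠ w : ℂ in 𝓝[≠] 0, ‖w‖ < 1 :=
        nhdsWithin_le_nhds ((isOpen_lt continuous_norm continuous_const).mem_nhds (by simp))
      filter_upwards [this] with w hw
      have e1 : ‖w⁻¹‖ - 1 ≤ ‖w + w⁻¹‖ := by
        have := norm_sub_le (w + w⁻¹) w
        rw [add_sub_cancel_left] at this
        linarith
      have e2 := norm_sub_le ((((a + b) / 2 : ℝ) : ℂ) + ((b - a) / 2 : ℝ) * ((w + w⁻¹) / 2))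
        (((a + b) / 2 : ℝ) : ℂ)
      rw [add_sub_cancel_left, norm_mul, norm_div, Complex.norm_real, Real.norm_of_nonneg
        (by linarith : 0 ≤ (b - a) / 2), Complex.norm_ofNat] at e2
      nlinarith
    have h3 := OnePoint.tendsto_coe_infty.comp h1
    have h0 : joukowski a b 0 = OnePoint.infty := if_pos rfl
    rw [h0]
    refine h3.congr' ?_
    filter_upwards [self_mem_nhdsWithin] with w hw
    simp only [Set.mem_compl_iff, Set.mem_singleton_iff] at hw
    simp only [Function.comp_apply, joukowski, if_neg hw]
  · have : (fun w : ℂ => ((((((a + b) / 2 : ℝ) : ℂ) +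
        ((b - a) / 2 : ℝ) * ((w + w⁻¹) / 2) : ℂ)) : OnePoint ℂ)) =ᶠ[𝓝 w] joukowski a b := by
      filter_upwards [isOpen_ne.mem_nhds hw] with v hv
      simp only [joukowski, if_neg hv]
    refine ContinuousAt.congr ?_ this
    refine OnePoint.continuous_coe.continuousAt.comp ?_
    have := continuousAt_inv₀ hw
    fun_prop

theorem joukowski_injOn {a b : ℝ} (hab : a < b) {w v : ℂ} (hw : ‖w‖ < 1) (hv : ‖v‖ < 1)
    (h : joukowski a b w = joukowski a b v) : w = v := by
  have hba : (((b - a) / 2 : ℝ) : ℂ) ≠ 0 := by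
    rw [Complex.ofReal_ne_zero]; linarith
  unfold joukowski at h
  split_ifs at h with h1 h2 h2
  · rw [h1, h2]
  · exact absurd h (OnePoint.infty_ne_coe _)
  · exact absurd h (OnePoint.coe_ne_infty _)
  · have h := mul_left_cancel₀ hba (add_left_cancel (OnePoint.coe_injective h))
    have h3 : (w - v) * (w * v - 1) = 0 := by
      field_simp at h
      linear_combination h
    rcases mul_eq_zero.mp h3 with h4 | h4
    · exact sub_eq_zero.mp h4
    · have : ‖w‖ * ‖v‖ = 1 := by rw [← norm_mul, sub_eq_zero.mp h4, norm_one]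
      nlinarith [norm_nonneg w, norm_nonneg v]

theorem joukowski_of_norm_eq_one {a b : ℝ} (hab : a < b) {w : ℂ} (hw : ‖w‖ = 1) :
    ∃ x ∈ Set.Icc a b, joukowski a b w = ((x : ℂ) : OnePoint ℂ) := by
  have h0 : w ≠ 0 := by rintro rfl; simp at hw
  refine ⟨(a + b) / 2 + (b - a) / 2 * w.re, ?_, ?_⟩
  · have := abs_le.mp ((Complex.abs_re_le_norm w).trans hw.le)
    constructor <;> nlinarith
  · have : (w + w⁻¹) / 2 = (w.re : ℂ) := by
      rw [Complex.inv_eq_conj hw, Complex.add_conj]; simp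
    rw [joukowski, if_neg h0, this]
    push_cast
    rfl

theorem joukowski_notMem {a b : ℝ} (hab : a < b) {w : ℂ} (hw : ‖w‖ < 1) {x : ℝ}
    (hx : x ∈ Set.Icc a b) : joukowski a b w ≠ ((x : ℂ) : OnePoint ℂ) := by
  intro h
  unfold joukowski at h
  split_ifs at h with h0
  · exact OnePoint.infty_ne_coe _ h
  have h := OnePoint.coe_injective h
  obtain ⟨t, rfl⟩ : ∃ t : ℝ, x = (a + b) / 2 + (b - a) / 2 * t :=
    ⟨(x - (a + b) / 2) / ((b - a) / 2), by have : b - a ≠ 0 := by linarith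
                                           field_simp; ring⟩
  have ht1 : -1 ≤ t := by by_contra hlt; nlinarith [hx.1]
  have ht2 : t ≤ 1 := by by_contra hlt; nlinarith [hx.2]
  have hba : (((b - a) / 2 : ℝ) : ℂ) ≠ 0 := by
    rw [Complex.ofReal_ne_zero]; linarith
  rw [Complex.ofReal_add, Complex.ofReal_mul] at h
  have h := mul_left_cancel₀ hba (add_left_cancel h)
  have h : w ^ 2 - 2 * t * w + 1 = 0 := by
    field_simp at h
    linear_combination h
  have hre := congrArg Complex.re h
  have him := congrArg Complex.im h
  simp [pow_two] at hre him
  have hn : w.re * w.re + w.im * w.im < 1 := by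
    have := Complex.sq_norm w
    rw [Complex.normSq_apply] at this
    rw [← this]; nlinarith [norm_nonneg w]
  have h5 : (w.re - t) * w.im = 0 := by linarith
  rcases mul_eq_zero.mp h5 with h6 | h6
  · have : w.re = t := sub_eq_zero.mp h6
    rw [this] at hre hn; nlinarith
  · rw [h6] at hre hn
    nlinarith [sq_nonneg (w.re - t), sq_nonneg (w.re-1), sq_nonneg (w.re+1)]

theorem exists_joukowski_eq {a b : ℝ} (hab : a < b) (z : OnePoint ℂ) :
    ∃ w : ℂ, ‖w‖ ≤ 1 ∧ joukowski a b w = z := by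
  induction z using OnePoint.rec with
  | infty => exact ⟨0, by simp, by simp [joukowski]⟩
  | coe z =>
    have hba : (((b - a) / 2 : ℝ) : ℂ) ≠ 0 := by
      rw [Complex.ofReal_ne_zero]; linarith
    obtain ⟨u, hu⟩ : ∃ u : ℂ, z = (((a + b) / 2 : ℝ) : ℂ) + ((b - a) / 2 : ℝ) * u :=
      ⟨(z - (((a + b) / 2 : ℝ) : ℂ)) / ((b - a) / 2 : ℝ), by
        rw [mul_div_cancel₀ _ hba]; ring⟩
    obtain ⟨s, hs⟩ := IsAlgClosed.exists_pow_nat_eq (u ^ 2 - 1) (n := 2) (by norm_num)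
    have key : ∃ w : ℂ, ‖w‖ ≤ 1 ∧ w ≠ 0 ∧ (w + w⁻¹) / 2 = u := by
      have hmul : (u + s) * (u - s) = 1 := by linear_combination -hs
      have h1 : u + s ≠ 0 := left_ne_zero_of_mul_eq_one hmul
      have h2 : u - s ≠ 0 := right_ne_zero_of_mul_eq_one hmul
      have hn : ‖u + s‖ * ‖u - s‖ = 1 := by rw [← norm_mul, hmul, norm_one]
      rcases le_or_gt ‖u + s‖ 1 with h | h
      · exact ⟨u + s, h, h1, by rw [inv_eq_of_mul_eq_one_right hmul]; ring⟩
      · refine ⟨u - s, ?_, h2, by rw [inv_eq_of_mul_eq_one_left hmul]; ring⟩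
        nlinarith [norm_nonneg (u - s)]
    obtain ⟨w, hw1, hw0, hw⟩ := key
    exact ⟨w, hw1, by rw [joukowski, if_neg hw0, hw, hu]⟩

variable {M : Type} [TopologicalSpace M] [T2Space M]

theorem CellSet.attach_disc {A : Set M} {c : ℤ} (hA : CellSet A c) {f : OnePoint ℂ → M}
    (hf : Continuous f) (hinj : Function.Injective f) {a b : ℝ} (hab : a < b)
    (hfA : ∀ z, f z ∈ A ↔ ∃ x ∈ Set.Icc a b, z = ((x : ℂ) : OnePoint ℂ)) :
    CellSet (A ∪ Set.range f) (c + 1) := by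
  let e : EuclideanSpace ℝ (Fin 2) ≃ₗᵢ[ℝ] ℂ := Complex.orthonormalBasisOneI.repr.symm
  have := hA.attach 2 (fun x => f (joukowski a b (e x)))
    (hf.comp ((continuous_joukowski hab).comp e.continuous)).continuousOn
    (fun x hx => (hfA _).mpr (joukowski_of_norm_eq_one hab ((e.norm_map x).trans hx)))
    (fun x hx h => by
      obtain ⟨y, hy, h⟩ := (hfA _).mp h
      exact joukowski_notMem hab (by rwa [e.norm_map]) hy h)
    (fun x y hx hy h => e.injective
      (joukowski_injOn hab (by rwa [e.norm_map]) (by rwa [e.norm_map]) (hinj h)))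
  convert this using 1
  swap
  · simp
  congr 1
  ext p
  constructor
  · rintro ⟨z, rfl⟩
    obtain ⟨w, hw, rfl⟩ := exists_joukowski_eq hab z
    exact ⟨e.symm w, by simpa [cellBall] using hw, by simp⟩
  · rintro ⟨x, -, rfl⟩
    exact ⟨_, rfl⟩

theorem CellSet.attach_arcs {f : ℝ → M} (hf : Continuous f) (hinj : Function.Injective f)
    (N : ℕ) : ∀ {A : Set M} {c : ℤ} {a b : ℝ} (S : Finset ℝ), CellSet A c →
      S.card = N + 1 → a ∈ S → b ∈ S → (∀ x ∈ S, x ∈ Set.Icc a b) →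
      (∀ x ∈ Set.Icc a b, f x ∈ A ↔ x ∈ S) → CellSet (A ∪ f '' Set.Icc a b) (c - N) := by
  induction N with
  | zero =>
    intro A c a b S hA hS ha hb _ hfA
    obtain ⟨y, rfl⟩ := Finset.card_eq_one.mp hS
    simp only [Finset.mem_singleton] at ha hb
    subst ha hb
    have : f b ∈ A := (hfA b (by simp)).mpr (by simp)
    simpa [this] using hA
  | succ N ih =>
    intro A c a b S hA hS ha hb hI hfA
    have hne : (S.erase a).Nonempty := by
      rw [← Finset.card_pos, Finset.card_erase_of_mem ha]; omega
    set m := (S.erase a).min' hne with hm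
    have hmS : m ∈ S.erase a := Finset.min'_mem _ _
    have hmS' : m ∈ S := Finset.mem_of_mem_erase hmS
    have ham : a < m := lt_of_le_of_ne (hI m hmS').1 (Finset.ne_of_mem_erase hmS).symm
    have hmb : m ≤ b := (hI m hmS').2
    have h1 : CellSet (A ∪ f '' Set.Icc a m) (c - 1) := by
      refine hA.attach_arc hf ham ((hfA a ⟨le_rfl, ham.le.trans hmb⟩).mpr ha)
        ((hfA m ⟨ham.le, hmb⟩).mpr hmS') hinj.injOn ?_
      intro x hx hxA
      have hxS := (hfA x ⟨hx.1.le, hx.2.le.trans hmb⟩).mp hxA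
      exact absurd (Finset.min'_le _ _ (Finset.mem_erase.mpr ⟨hx.1.ne', hxS⟩)) (not_le.mpr hx.2)
    have h2 := ih (a := m) (b := b) (S.erase a) h1
      (by rw [Finset.card_erase_of_mem ha]; omega) hmS
      (Finset.mem_erase.mpr ⟨(ham.trans_le hmb).ne', hb⟩)
      (fun x hx => ⟨Finset.min'_le _ _ hx, (hI x (Finset.mem_of_mem_erase hx)).2⟩) ?_
    · convert h2 using 1
      · rw [Set.union_assoc, ← Set.image_union, Set.Icc_union_Icc_eq_Icc ham.le hmb]
      · push_cast; ring
    · intro x hx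
      have hax : a < x := ham.trans_le hx.1
      rw [Finset.mem_erase, ← hfA x ⟨hax.le, hx.2⟩]
      constructor
      · rintro (h | ⟨y, hy, h⟩)
        · exact ⟨hax.ne', h⟩
        · have := hinj h
          subst this
          have : y = m := le_antisymm hy.2 hx.1
          exact ⟨hax.ne', this ▸ (hfA m ⟨ham.le, hmb⟩).mpr hmS'⟩
      · exact fun h => Or.inl h.2

/-- `C` is an embedded Riemann sphere, with a parametrization sending `∞` to any given point. -/
def IsSphere (C : Set M) : Prop :=
  C.Nonempty ∧ ∀ p ∈ C, ∃ f : OnePoint ℂ → M, Continuous f ∧ Function.Injective f ∧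
    Set.range f = C ∧ f OnePoint.infty = p

theorem CellSet.union_sphere {A C : Set M} {c : ℤ} (hA : CellSet A c) (hC : IsSphere C)
    (hfin : (A ∩ C).Finite) : CellSet (A ∪ C) (c + 2 - (A ∩ C).ncard) := by
  obtain ⟨p, hp, hpA⟩ : ∃ p ∈ C, p ∉ A := by
    by_contra! h
    obtain ⟨p, hp⟩ := hC.1
    obtain ⟨f, -, hinj, hr, -⟩ := hC.2 p hp
    refine Set.infinite_range_of_injective hinj ?_
    rw [hr]
    exact hfin.subset fun q hq => ⟨h q hq, hq⟩
  obtain ⟨f, hf, hinj, hr, hfp⟩ := hC.2 p hp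
  have hE : (f ⁻¹' A).Finite :=
    Set.Finite.of_finite_image
      (hfin.subset (by rintro _ ⟨z, hz, rfl⟩; exact ⟨hz, hr ▸ ⟨z, rfl⟩⟩)) hinj.injOn
  have hE' : {z : ℂ | f z ∈ A}.Finite :=
    hE.preimage (f := ((↑) : ℂ → OnePoint ℂ)) OnePoint.coe_injective.injOn
  obtain ⟨φ, hφ⟩ := exists_homeomorph_im_eq_zero hE'.toFinset
  let ψ := φ.symm.onePointCongr
  let g : OnePoint ℂ → M := f ∘ ψ
  have hg : Continuous g := hf.comp ψ.continuous
  have hginj : Function.Injective g := hinj.comp ψ.injective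
  have hgr : Set.range g = C := by rw [← hr]; exact ψ.surjective.range_comp f
  have hginf : g OnePoint.infty = p := hfp
  have hreal : ∀ z : ℂ, g z ∈ A → z.im = 0 := by
    intro z hz
    have hz : f (φ.symm z : ℂ) ∈ A := hz
    have := hφ (φ.symm z) (by simpa using hz)
    simpa using this
  let h : ℝ → M := fun x => g ((x : ℂ) : OnePoint ℂ)
  have hh : Continuous h := hg.comp (OnePoint.continuous_coe.comp Complex.continuous_ofReal)
  have hhinj : Function.Injective h :=
    hginj.comp (OnePoint.coe_injective.comp Complex.ofReal_injective)
  have himage : h '' (h ⁻¹' A) = A ∩ C := by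
    ext q
    constructor
    · rintro ⟨x, hx, rfl⟩
      exact ⟨hx, hgr ▸ ⟨_, rfl⟩⟩
    · rintro ⟨hq, hqC⟩
      rw [← hgr] at hqC
      obtain ⟨z, rfl⟩ := hqC
      induction z using OnePoint.rec with
      | infty => exact absurd (hginf ▸ hq) hpA
      | coe z =>
        have : ((z.re : ℝ) : ℂ) = z := Complex.ext rfl (by simp [hreal z hq])
        exact ⟨z.re, by simpa [h, this] using hq, by simp [h, this]⟩
  have hSfin : (h ⁻¹' A).Finite := Set.Finite.of_finite_image (himage ▸ hfin) hhinj.injOn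
  let S := hSfin.toFinset
  have hS : ∀ x, x ∈ S ↔ h x ∈ A := fun x => by simp [S]
  have hcard : (A ∩ C).ncard = S.card := by
    rw [← himage, Set.ncard_image_of_injective _ hhinj, Set.ncard_eq_toFinset_card _ hSfin]
  obtain ⟨a, ha⟩ : ∃ a : ℝ, ∀ x ∈ S, a < x := by
    obtain ⟨a, ha⟩ := S.bddBelow
    exact ⟨a - 1, fun x hx => by linarith [ha hx]⟩
  obtain ⟨b, hab, hb⟩ : ∃ b : ℝ, a < b ∧ ∀ x ∈ S, x < b := by
    obtain ⟨b, hb⟩ := S.bddAbove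
    exact ⟨max a b + 1, by linarith [le_max_left a b],
      fun x hx => by linarith [hb hx, le_max_right a b]⟩
  have haS : a ∉ S := fun h => lt_irrefl _ (ha a h)
  have hbS : b ∉ S := fun h => lt_irrefl _ (hb b h)
  have h1 := hA.insert_point fun hm => haS ((hS a).mpr hm)
  have h2 := h1.insert_point (p := h b) (by
    rintro (hm | hm)
    · exact hbS ((hS b).mpr hm)
    · exact hab.ne' (hhinj hm))
  have hT : ∀ x, h x ∈ A ∪ {h a} ∪ {h b} ↔ x ∈ insert b (insert a S) := by
    intro x
    simp only [Set.mem_union, Set.mem_singleton_iff, Finset.mem_insert, hhinj.eq_iff, hS]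
    tauto
  have h3 := CellSet.attach_arcs hh hhinj (S.card + 1) (a := a) (b := b)
    (insert b (insert a S)) h2
    (by rw [Finset.card_insert_of_notMem (by simp [hbS, hab.ne']),
          Finset.card_insert_of_notMem haS]) (by simp) (by simp)
    (by
      intro x hx
      simp only [Finset.mem_insert] at hx
      rcases hx with rfl | rfl | hx
      · exact ⟨hab.le, le_rfl⟩
      · exact ⟨le_rfl, hab.le⟩
      · exact ⟨(ha x hx).le, (hb x hx).le⟩)
    (fun x _ => hT x)
  have h4 := h3.attach_disc hg hginj hab (by
    intro z
    constructor
    · rintro (((hz | hz) | hz) | ⟨x, hx, hz⟩)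
      · induction z using OnePoint.rec with
        | infty => exact absurd (hginf ▸ hz) hpA
        | coe z =>
          have : ((z.re : ℝ) : ℂ) = z := Complex.ext rfl (by simp [hreal z hz])
          have hzS : z.re ∈ S := (hS _).mpr (by simpa [h, this] using hz)
          exact ⟨z.re, ⟨(ha _ hzS).le, (hb _ hzS).le⟩, by rw [this]⟩
      · exact ⟨a, ⟨le_rfl, hab.le⟩, hginj hz⟩
      · exact ⟨b, ⟨hab.le, le_rfl⟩, hginj hz⟩
      · exact ⟨x, hx, (hginj hz).symm⟩
    · rintro ⟨x, hx, rfl⟩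
      exact Or.inr ⟨x, hx, rfl⟩)
  convert h4 using 1
  · rw [hgr]
    have : h '' Set.Icc a b ⊆ C := by
      rintro _ ⟨x, -, rfl⟩; exact hgr ▸ ⟨_, rfl⟩
    have ha' : h a ∈ C := hgr ▸ ⟨_, rfl⟩
    have hb' : h b ∈ C := hgr ▸ ⟨_, rfl⟩
    ext q
    simp only [Set.mem_union, Set.mem_singleton_iff]
    constructor
    · tauto
    · rintro ((((hq | rfl) | rfl) | hq) | hq)
      · exact Or.inl hq
      · exact Or.inr ha'
      · exact Or.inr hb'
      · exact Or.inr (this hq)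
      · exact Or.inr hq
  · rw [hcard]; push_cast; ring

end

noncomputable section

open scoped Manifold Topology
open Filter

/-! ### The projective plane -/

theorem mkP_of_ne_zero {v : Fin 3 → ℂ} (hv : v ≠ 0) : mkP v = Projectivization.mk ℂ v hv :=
  dif_pos hv

theorem mkP_eq_mkP_iff {v w : Fin 3 → ℂ} (hv : v ≠ 0) (hw : w ≠ 0) :
    mkP v = mkP w ↔ ∃ c : ℂ, v = c • w := by
  rw [mkP_of_ne_zero hv, mkP_of_ne_zero hw, Projectivization.mk_eq_mk_iff']
  simp only [eq_comm]

theorem mkP_smul {c : ℂ} (hc : c ≠ 0) {v : Fin 3 → ℂ} (hv : v ≠ 0) : mkP (c • v) = mkP v :=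
  (mkP_eq_mkP_iff (smul_ne_zero hc hv) hv).mpr ⟨c, rfl⟩

theorem exists_mkP_eq (p : P2) : ∃ v : Fin 3 → ℂ, ‖v‖ = 1 ∧ p = mkP v := by
  induction p using Projectivization.ind with
  | h v hv =>
    have hn : (‖v‖ : ℂ) ≠ 0 := by simpa using hv
    refine ⟨(‖v‖ : ℂ)⁻¹ • v, ?_, ?_⟩
    · rw [norm_smul, norm_inv, Complex.norm_real, norm_norm, inv_mul_cancel₀ (by simpa using hv)]
    · rw [mkP_smul (inv_ne_zero hn) hv, mkP_of_ne_zero hv]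

theorem continuousOn_mkP : ContinuousOn mkP {v | v ≠ 0} := by
  rw [continuousOn_iff_continuous_domRestrict]
  have : Set.domRestrict {v | v ≠ 0} mkP =
      fun v : {v : Fin 3 → ℂ // v ≠ 0} => Projectivization.mk ℂ v.1 v.2 := by
    funext v
    exact mkP_of_ne_zero v.2
  rw [this]
  exact continuous_quotient_mk'

theorem continuousAt_mkP {v : Fin 3 → ℂ} (hv : v ≠ 0) : ContinuousAt mkP v :=
  continuousOn_mkP.continuousAt (isOpen_ne.mem_nhds hv)

/-- The matrix of the orthogonal projection to the line spanned by `v`. -/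
def projMat (v : Fin 3 → ℂ) : Fin 3 → Fin 3 → ℂ :=
  fun a b => v a * star (v b) / ∑ k, v k * star (v k)

open ComplexOrder in
theorem sum_mul_star_ne_zero {v : Fin 3 → ℂ} (hv : v ≠ 0) : ∑ k, v k * star (v k) ≠ 0 := by
  have : v ⬝ᵥ star v ≠ 0 := fun h => hv (dotProduct_self_star_eq_zero.mp h)
  simpa [dotProduct] using this

theorem projMat_smul {c : ℂ} (hc : c ≠ 0) (v : Fin 3 → ℂ) : projMat (c • v) = projMat v := by
  have hc' : star c ≠ 0 := star_ne_zero.mpr hc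
  funext a b
  have : ∑ k, (c • v) k * star ((c • v) k) = (c * star c) * ∑ k, v k * star (v k) := by
    rw [Finset.mul_sum]
    refine Finset.sum_congr rfl fun k _ => ?_
    simp only [Pi.smul_apply, smul_eq_mul, star_mul]; ring
  rw [projMat, this, projMat]
  have h2 : (c • v) a * star ((c • v) b) = (c * star c) * (v a * star (v b)) := by
    simp only [Pi.smul_apply, smul_eq_mul, star_mul]; ring
  rw [h2, mul_div_mul_left _ _ (mul_ne_zero hc hc')]

theorem eq_smul_of_projMat_eq {v w : Fin 3 → ℂ} (hv : v ≠ 0) (h : projMat v = projMat w) :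
    ∃ c : ℂ, v = c • w := by
  obtain ⟨b, hb⟩ := Function.ne_iff.mp hv
  refine ⟨star (w b) / (∑ k, w k * star (w k)) * ((∑ k, v k * star (v k)) / star (v b)), ?_⟩
  funext a
  have hab := congrFun (congrFun h a) b
  have hb' : star (v b) ≠ 0 := star_ne_zero.mpr hb
  have hs := sum_mul_star_ne_zero hv
  unfold projMat at hab
  rw [div_eq_iff hs] at hab
  calc v a = (v a * star (v b)) / star (v b) := (mul_div_cancel_right₀ _ hb').symm
    _ = _ := by rw [hab, Pi.smul_apply, smul_eq_mul]; ring

instance : T2Space P2 := by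
  let F : P2 → Fin 3 → Fin 3 → ℂ := Projectivization.lift (fun v => projMat v.1) (by
    rintro ⟨v, hv⟩ ⟨w, hw⟩ t (rfl : v = t • w)
    exact projMat_smul (by rintro rfl; simp at hv) w)
  refine T2Space.of_injective_continuous (f := F) ?_ ?_
  · intro p q h
    induction p using Projectivization.ind with
    | h v hv =>
      induction q using Projectivization.ind with
      | h w hw =>
        obtain ⟨c, hc⟩ := eq_smul_of_projMat_eq hv (h : projMat v = projMat w)
        rw [Projectivization.mk_eq_mk_iff']
        exact ⟨c, hc.symm⟩
  · refine Continuous.quotient_lift ?_ _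
    unfold projMat
    have hc : ∀ a, Continuous fun v : {v : Fin 3 → ℂ // v ≠ 0} => v.1 a := fun a =>
      (continuous_apply a).comp continuous_subtype_val
    exact continuous_pi fun a => continuous_pi fun b => ((hc a).mul (hc b).star).div
      (continuous_finsetSum _ fun k _ => (hc k).mul (hc k).star)
      fun v => sum_mul_star_ne_zero v.2

/-- The image in `(ℙ²)ⁿ` of a closed set of tuples of unit vectors is closed. -/
theorem isClosed_image_mkP {n : ℕ} {X : Type} [TopologicalSpace X] {K : Set X} (hK : IsCompact K)
    {x : X → Fin n → Fin 3 → ℂ} (hx : ContinuousOn x K) (h0 : ∀ t ∈ K, ∀ i, x t i ≠ 0) :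
    IsClosed ((fun t i => mkP (x t i)) '' K) := by
  refine (hK.image_of_continuousOn ?_).isClosed
  refine continuousOn_pi.mpr fun i => ?_
  exact continuousOn_mkP.comp (continuousOn_pi.mp hx i) fun t ht => h0 t ht i

theorem isCompact_unit (n : ℕ) : IsCompact {x : Fin n → Fin 3 → ℂ | ∀ i, ‖x i‖ = 1} := by
  have := isCompact_univ_pi fun _ : Fin n => isCompact_sphere (0 : Fin 3 → ℂ) 1
  convert this using 1
  ext x
  simp

/-! ### Projective lines -/

/-- The projective line spanned by `a` and `b`, as a map from the Riemann sphere. -/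
def lineMap (a b : Fin 3 → ℂ) : OnePoint ℂ → P2
  | OnePoint.infty => mkP b
  | OnePoint.some z => mkP (a + z • b)

theorem continuous_lineMap {a b : Fin 3 → ℂ} (hb : b ≠ 0) (h : ∀ z : ℂ, a + z • b ≠ 0) :
    Continuous (lineMap a b) := by
  rw [continuous_iff_continuousAt]
  intro z
  induction z using OnePoint.rec with
  | infty =>
    rw [OnePoint.continuousAt_infty', coclosedCompact_eq_cocompact,
      ← Metric.cobounded_eq_cocompact]
    have h1 : Tendsto (fun z : ℂ => z⁻¹ • a + b) (Bornology.cobounded ℂ) (𝓝 b) := by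
      have : Tendsto (fun z : ℂ => z⁻¹ • a + b) (Bornology.cobounded ℂ) (𝓝 ((0 : ℂ) • a + b)) :=
        (tendsto_inv₀_cobounded.smul_const a).add_const b
      simpa using this
    refine ((continuousAt_mkP hb).tendsto.comp h1).congr' ?_
    filter_upwards [Bornology.eventually_ne_cobounded (0 : ℂ)] with z hz
    have : z⁻¹ • a + b = z⁻¹ • (a + z • b) := by
      rw [smul_add, smul_smul, inv_mul_cancel₀ hz, one_smul]
    simp only [Function.comp_apply]
    rw [this, mkP_smul (inv_ne_zero hz) (h z)]
    rfl
  | coe z =>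
    rw [OnePoint.continuousAt_coe]
    exact ContinuousAt.comp (f := fun z : ℂ => a + z • b) (continuousAt_mkP (h z)) (by fun_prop)

theorem lineMap_injective {a b : Fin 3 → ℂ} (h : ∀ s t : ℂ, s • a + t • b = 0 → s = 0 ∧ t = 0) :
    Function.Injective (lineMap a b) := by
  have hb : b ≠ 0 := by
    rintro rfl
    simpa using h 0 1 (by simp)
  have hz : ∀ z : ℂ, a + z • b ≠ 0 := fun z h0 => by
    simpa using h 1 z (by rw [one_smul, h0])
  have aux : ∀ z : ℂ, mkP (a + z • b) ≠ mkP b := by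
    intro z he
    obtain ⟨c, hc⟩ := (mkP_eq_mkP_iff (hz z) hb).mp he
    simpa using (h 1 (z - c) (by rw [sub_smul, ← hc, one_smul]; abel)).1
  intro z w hzw
  induction z using OnePoint.rec with
  | infty =>
    induction w using OnePoint.rec with
    | infty => rfl
    | coe w => exact absurd hzw.symm (aux w)
  | coe z =>
    induction w using OnePoint.rec with
    | infty => exact absurd hzw (aux z)
    | coe w =>
      obtain ⟨c, hc⟩ := (mkP_eq_mkP_iff (hz z) (hz w)).mp hzw
      have := h (1 - c) (z - c * w) (by
        rw [smul_add, smul_smul] at hc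
        rw [sub_smul, sub_smul, one_smul]
        linear_combination (exp := 1) hc)
      have h1 : c = 1 := (sub_eq_zero.mp this.1).symm
      rw [h1, one_mul] at this
      rw [sub_eq_zero.mp this.2]

end

noncomputable section

open scoped Manifold Topology
open Filter

/-! ### The multiview variety as an incidence variety -/

variable {n : ℕ} {A : Fin n → Matrix (Fin 3) (Fin 4) ℂ} {Cs : Fin n → Matrix (Fin 3) (Fin 3) ℂ}

/-- `y` is a world point all of whose images lie on the lines `P i`. -/
def IsWitness (A : Fin n → Matrix (Fin 3) (Fin 4) ℂ) (y : Fin 4 → ℂ) (P : Fin n → P2) : Prop :=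
  y ≠ 0 ∧ ∀ i, ∃ x : Fin 3 → ℂ, x ≠ 0 ∧ P i = mkP x ∧ ∃ t : ℂ, (A i).mulVec y = t • x

theorem IsWitness.exists_eq_smul {y : Fin 4 → ℂ} {P : Fin n → P2} (h : IsWitness A y P) {i : Fin n}
    {x : Fin 3 → ℂ} (hx : x ≠ 0) (hP : P i = mkP x) : ∃ t : ℂ, (A i).mulVec y = t • x := by
  obtain ⟨x', hx', hP', t, ht⟩ := h.2 i
  obtain ⟨c, rfl⟩ := (mkP_eq_mkP_iff hx' hx).mp (hP' ▸ hP)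
  exact ⟨t * c, by rw [ht, smul_smul]⟩

theorem IsWitness.eq_mkP {y : Fin 4 → ℂ} {P : Fin n → P2} (h : IsWitness A y P) {i : Fin n}
    (hi : (A i).mulVec y ≠ 0) : P i = mkP ((A i).mulVec y) := by
  obtain ⟨x, hx, hP, t, ht⟩ := h.2 i
  have : t ≠ 0 := by rintro rfl; exact hi (by rw [ht, zero_smul])
  rw [hP, ht, mkP_smul this hx]

theorem isClosed_setOf_isWitness : IsClosed {P | ∃ y, IsWitness A y P} := by
  let K : Set ((Fin 4 → ℂ) × (Fin n → Fin 3 → ℂ)) :=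
    (Metric.sphere 0 1 ×ˢ {x | ∀ i, ‖x i‖ = 1}) ∩
      {p | ∀ i a b, (A i).mulVec p.1 a * p.2 i b = (A i).mulVec p.1 b * p.2 i a}
  have hK : IsCompact K := by
    refine ((isCompact_sphere _ _).prod (isCompact_unit n)).inter_right ?_
    simp only [Set.ofPred_forall]
    have hA : ∀ i, Continuous fun p : (Fin 4 → ℂ) × (Fin n → Fin 3 → ℂ) => (A i).mulVec p.1 :=
      fun i => (Continuous.matrix_mulVec continuous_const continuous_fst)
    refine isClosed_iInter fun i => isClosed_iInter fun a => isClosed_iInter fun b =>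
      isClosed_eq ?_ ?_
    · have := (continuous_apply a).comp (hA i)
      exact this.mul (by fun_prop)
    · have := (continuous_apply b).comp (hA i)
      exact this.mul (by fun_prop)
  have h0 : ∀ p ∈ K, ∀ i, p.2 i ≠ 0 := fun p hp i h => by
    have := hp.1.2 i
    simp [h] at this
  convert isClosed_image_mkP hK (x := fun p => p.2) (by fun_prop) h0 using 1
  ext P
  constructor
  · rintro ⟨y, hy, hP⟩
    choose x hx using fun i => exists_mkP_eq (P i)
    have hx0 : ∀ i, x i ≠ 0 := fun i h => by simpa [h] using (hx i).1
    refine ⟨(((‖y‖ : ℂ)⁻¹) • y, x), ⟨⟨?_, fun i => (hx i).1⟩, fun i a b => ?_⟩, ?_⟩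
    · rw [mem_sphere_zero_iff_norm, norm_smul, norm_inv, Complex.norm_real, norm_norm,
        inv_mul_cancel₀ (by simpa using hy)]
    · obtain ⟨t, ht⟩ := IsWitness.exists_eq_smul ⟨hy, hP⟩ (hx0 i) (hx i).2
      simp only [Matrix.mulVec_smul, ht, Pi.smul_apply, smul_eq_mul]
      ring
    · funext i
      exact (hx i).2.symm
  · rintro ⟨⟨y, x⟩, hp, rfl⟩
    refine ⟨y, ?_, fun i => ⟨x i, h0 _ hp i, rfl, ?_⟩⟩
    · rintro rfl
      simpa using hp.1.1
    · obtain ⟨b, hb⟩ := Function.ne_iff.mp (h0 _ hp i)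
      refine ⟨(A i).mulVec y b / x i b, ?_⟩
      funext a
      have := hp.2 i a b
      simp only [Pi.zero_apply] at hb
      rw [Pi.smul_apply, smul_eq_mul, div_mul_eq_mul_div, eq_div_iff hb]
      exact this

theorem mvVariety_eq (hA : ∀ i, Function.Surjective (A i).mulVec)
    (h0 : ∀ i j y, i ≠ j → (A i).mulVec y = 0 → (A j).mulVec y = 0 → y = 0) :
    mvVariety A = {P | ∃ y, IsWitness A y P} := by
  apply Set.Subset.antisymm
  · refine closure_minimal ?_ isClosed_setOf_isWitness
    rintro P ⟨y, hy, hi, hP⟩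
    exact ⟨y, hy, fun i => ⟨_, hi i, hP i, 1, (one_smul _ _).symm⟩⟩
  · rintro P ⟨y, hy⟩
    by_cases hall : ∀ i, (A i).mulVec y ≠ 0
    · exact subset_closure ⟨y, hy.1, hall, fun i => hy.eq_mkP (hall i)⟩
    push Not at hall
    obtain ⟨i, hi⟩ := hall
    obtain ⟨x, hx, hPx, -⟩ := hy.2 i
    obtain ⟨v, hv⟩ := hA i x
    have hne : ∀ k, k ≠ i → (A k).mulVec y ≠ 0 := fun k hk h => hy.1 (h0 k i y hk h hi)
    have hi' : ∀ ε : ℂ, (A i).mulVec (y + ε • v) = ε • x := fun ε => by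
      rw [Matrix.mulVec_add, hi, zero_add, Matrix.mulVec_smul, hv]
    have hcont : ∀ k, Tendsto (fun ε : ℂ => (A k).mulVec (y + ε • v)) (𝓝[≠] 0)
        (𝓝 ((A k).mulVec y)) := fun k => by
      have : Continuous fun ε : ℂ => (A k).mulVec (y + ε • v) :=
        Continuous.matrix_mulVec continuous_const (by fun_prop)
      simpa using (this.tendsto 0).mono_left nhdsWithin_le_nhds
    refine mem_closure_of_tendsto (b := 𝓝[≠] (0 : ℂ))
      (f := fun ε k => mkP ((A k).mulVec (y + ε • v))) ?_ ?_
    · refine tendsto_pi_nhds.mpr fun k => ?_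
      by_cases hk : k = i
      · subst hk
        refine tendsto_const_nhds.congr' ?_
        filter_upwards [self_mem_nhdsWithin] with ε hε
        rw [hi', mkP_smul hε hx, hPx]
      · rw [hy.eq_mkP (hne k hk)]
        exact (continuousAt_mkP (hne k hk)).tendsto.comp (hcont k)
    · have hev : ∀ᶠ ε : ℂ in 𝓝[≠] 0, ∀ k, (A k).mulVec (y + ε • v) ≠ 0 := by
        refine eventually_all.mpr fun k => ?_
        by_cases hk : k = i
        · subst hk
          filter_upwards [self_mem_nhdsWithin] with ε hε
          rw [hi']
          exact smul_ne_zero hε hx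
        · exact (hcont k).eventually_ne (hne k hk)
      filter_upwards [hev] with ε hε
      refine ⟨_, ?_, hε, fun _ => rfl⟩
      intro h
      exact hε i (by rw [h, Matrix.mulVec_zero])

/-! ### The closure of the affine quadric -/

theorem mulVec_ne_zero {Cm : Matrix (Fin 3) (Fin 3) ℂ} (hC : IsUnit Cm.det) {w : Fin 3 → ℂ}
    (hw : w ≠ 0) : Cm.mulVec w ≠ 0 := fun h =>
  hw (Matrix.mulVec_injective_of_isUnit ((Matrix.isUnit_iff_isUnit_det _).mpr hC)
    (h.trans (Matrix.mulVec_zero _).symm))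

theorem affLift_ne_zero (u : Fin 2 → ℂ) : affLift u ≠ 0 := fun h =>
  one_ne_zero (congrFun h 0 : (1 : ℂ) = 0)

theorem exists_mkP_mulVec_eq {Cm : Matrix (Fin 3) (Fin 3) ℂ} (hC : IsUnit Cm.det) (p : P2) :
    ∃ w : Fin 3 → ℂ, w ≠ 0 ∧ p = mkP (Cm.mulVec w) := by
  obtain ⟨x, hx, rfl⟩ := exists_mkP_eq p
  have : Cm.mulVec (Cm⁻¹.mulVec x) = x := by
    rw [Matrix.mulVec_mulVec, Matrix.mul_nonsing_inv _ hC, Matrix.one_mulVec]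
  refine ⟨Cm⁻¹.mulVec x, ?_, by rw [this]⟩
  intro h
  rw [h, Matrix.mulVec_zero] at this
  simp [← this] at hx

theorem mkP_mulVec_eq_iff {Cm : Matrix (Fin 3) (Fin 3) ℂ} (hC : IsUnit Cm.det) {v w : Fin 3 → ℂ}
    (hv : v ≠ 0) (hw : w ≠ 0) :
    mkP (Cm.mulVec v) = mkP (Cm.mulVec w) ↔ ∃ c : ℂ, v = c • w := by
  rw [mkP_eq_mkP_iff (mulVec_ne_zero hC hv) (mulVec_ne_zero hC hw)]
  simp only [← Matrix.mulVec_smul]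
  exact exists_congr fun c =>
    (Matrix.mulVec_injective_of_isUnit ((Matrix.isUnit_iff_isUnit_det _).mpr hC)).eq_iff

theorem mkP_mem_infLine_iff {Cm : Matrix (Fin 3) (Fin 3) ℂ} (hC : IsUnit Cm.det) {w : Fin 3 → ℂ}
    (hw : w ≠ 0) : mkP (Cm.mulVec w) ∈ infLine Cm ↔ w 0 = 0 := by
  constructor
  · rintro ⟨w', hw', h0, h⟩
    obtain ⟨c, rfl⟩ := (mkP_mulVec_eq_iff hC hw hw').mp h
    simp [h0]
  · exact fun h0 => ⟨w, hw, h0, rfl⟩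

/-- The index equivalence underlying `camCoord`. -/
def camIdx (n : ℕ) : Fin n × Fin 2 ≃ Fin (2 * n) where
  toFun p := ⟨2 * p.1.1 + p.2.1, by have := p.1.2; have := p.2.2; omega⟩
  invFun m := (⟨m.1 / 2, by have := m.2; omega⟩, ⟨m.1 % 2, by omega⟩)
  left_inv p := by
    have := p.2.2
    refine Prod.ext (Fin.ext ?_) (Fin.ext ?_) <;> simp <;> omega
  right_inv m := Fin.ext (by simp; omega)

theorem exists_camCoord_eq (u : Fin n → Fin 2 → ℂ) : ∃ z, ∀ i, camCoord n z i = u i :=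
  ⟨fun m => u ((camIdx n).symm m).1 ((camIdx n).symm m).2, fun i => funext fun k => by
    have : (⟨2 * i.1 + k.1, by have := i.2; have := k.2; omega⟩ : Fin (2 * n)) = camIdx n (i, k) :=
      rfl
    rw [camCoord, this, Equiv.symm_apply_apply]⟩

/-- The contribution of the `i`-th factor to the quadric, in homogeneous coordinates. -/
def quadTerm (β : Fin (2 * n + 1) → ℂ) (i : Fin n) (w : Fin 3 → ℂ) : ℂ :=
  ∑ k : Fin 2, (w k.succ - camCoord n (fun m => β m.succ) i k * w 0) ^ 2

theorem mem_quadSet_iff {β : Fin (2 * n + 1) → ℂ} {z : Fin (2 * n) → ℂ} :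
    z ∈ quadSet n β ↔ ∑ i, quadTerm β i (affLift (camCoord n z i)) + β 0 = 0 := by
  have : ∑ m : Fin (2 * n), (z m - β m.succ) ^ 2 =
      ∑ i, quadTerm β i (affLift (camCoord n z i)) := by
    rw [← (camIdx n).sum_comp, Fintype.sum_prod_type]
    refine Finset.sum_congr rfl fun i _ => Finset.sum_congr rfl fun k _ => ?_
    simp [affLift, camCoord, camIdx]
  rw [quadSet, Set.mem_ofPred_eq, this]

theorem quadTerm_smul (β : Fin (2 * n + 1) → ℂ) (i : Fin n) (c : ℂ) (w : Fin 3 → ℂ) :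
    quadTerm β i (c • w) = c ^ 2 * quadTerm β i w := by
  rw [quadTerm, quadTerm, Finset.mul_sum]
  refine Finset.sum_congr rfl fun k _ => ?_
  simp only [Pi.smul_apply, smul_eq_mul]
  ring

/-- The multihomogenization of the equation of the quadric. -/
def quadForm (β : Fin (2 * n + 1) → ℂ) (w : Fin n → Fin 3 → ℂ) : ℂ :=
  ∑ i, quadTerm β i (w i) * ∏ j ∈ Finset.univ.erase i, w j 0 ^ 2 + β 0 * ∏ j, w j 0 ^ 2

theorem continuous_quadForm (β : Fin (2 * n + 1) → ℂ) : Continuous (quadForm β) := by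
  unfold quadForm quadTerm
  fun_prop

theorem HQ_subset (hC : ∀ i, IsUnit (Cs i).det) (β : Fin (2 * n + 1) → ℂ) {P : Fin n → P2}
    (hP : P ∈ HQ Cs β) :
    ∃ w : Fin n → Fin 3 → ℂ, (∀ i, w i ≠ 0) ∧ (∀ i, P i = mkP ((Cs i).mulVec (w i))) ∧
      quadForm β w = 0 := by
  let K : Set (Fin n → Fin 3 → ℂ) := {w | ∀ i, ‖w i‖ = 1} ∩ {w | quadForm β w = 0}
  have hK : IsCompact K :=
    (isCompact_unit n).inter_right (isClosed_eq (continuous_quadForm β) continuous_const)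
  have h0 : ∀ w ∈ K, ∀ i, w i ≠ 0 := fun w hw i h => by
    have := hw.1 i
    simp [h] at this
  have hcl := isClosed_image_mkP hK (x := fun w i => (Cs i).mulVec (w i))
    (continuous_pi fun i => Continuous.matrix_mulVec continuous_const
      (continuous_apply i)).continuousOn fun w hw i => mulVec_ne_zero (hC i) (h0 w hw i)
  have hsub : HQ Cs β ⊆ _ := closure_minimal (t := (fun (w : Fin n → Fin 3 → ℂ) i =>
    mkP ((Cs i).mulVec (w i))) '' K) ?_ hcl
  · obtain ⟨w, hw, rfl⟩ := hsub hP
    exact ⟨w, h0 w hw, fun _ => rfl, hw.2⟩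
  rintro _ ⟨z, hz, rfl⟩
  rw [mem_quadSet_iff] at hz
  let c : Fin n → ℂ := fun i => (‖affLift (camCoord n z i)‖ : ℂ)⁻¹
  have hc : ∀ i, c i ≠ 0 := fun i =>
    inv_ne_zero (Complex.ofReal_ne_zero.mpr (norm_ne_zero_iff.mpr (affLift_ne_zero _)))
  refine ⟨fun i => c i • affLift (camCoord n z i), ⟨fun i => ?_, ?_⟩, ?_⟩
  · rw [norm_smul, norm_inv, Complex.norm_real, norm_norm,
      inv_mul_cancel₀ (norm_ne_zero_iff.mpr (affLift_ne_zero _))]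
  · have h1 : ∀ j, (c j • affLift (camCoord n z j)) 0 = c j := fun j => by simp [affLift]
    rw [Set.mem_ofPred_eq, quadForm]
    simp only [h1, quadTerm_smul]
    rw [← mul_zero (∏ j, c j ^ 2), ← hz, mul_add, Finset.mul_sum]
    congr 1
    · refine Finset.sum_congr rfl fun i _ => ?_
      rw [← Finset.mul_prod_erase _ _ (Finset.mem_univ i)]
      ring
    · ring
  · funext i
    simp only [Matrix.mulVec_smul]
    exact mkP_smul (hc i) (mulVec_ne_zero (hC i) (affLift_ne_zero _))

/-- The two square roots of `-1`. -/
def sgn (s : Bool) : ℂ := if s then Complex.I else -Complex.I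

theorem sgn_mul_self (s : Bool) : sgn s * sgn s = -1 := by cases s <;> simp [sgn]

theorem sgn_injective : Function.Injective sgn := by
  have : Complex.I ≠ -Complex.I := fun h => by
    have := congrArg Complex.im h
    norm_num at this
  intro s t h
  cases s <;> cases t <;> simp_all [sgn, eq_comm]

/-- The isotropic points at infinity. -/
def isoVec (s : Bool) : Fin 3 → ℂ := ![0, 1, sgn s]

theorem isoVec_ne_zero (s : Bool) : isoVec s ≠ 0 := fun h => by
  simpa [isoVec] using congrFun h 1

theorem exists_eq_smul_isoVec {w : Fin 3 → ℂ} (h0 : w 0 = 0) (h : w 1 ^ 2 + w 2 ^ 2 = 0) :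
    ∃ s, w = w 1 • isoVec s := by
  have : (w 2 - sgn true * w 1) * (w 2 - sgn false * w 1) = 0 := by
    simp only [sgn, if_true, if_false, Bool.false_eq_true]
    linear_combination h - w 1 ^ 2 * Complex.I_sq
  rcases mul_eq_zero.mp this with h | h
  · refine ⟨true, funext fun i => ?_⟩
    fin_cases i <;> simp [isoVec, h0, sub_eq_zero.mp h, mul_comm]
  · refine ⟨false, funext fun i => ?_⟩
    fin_cases i <;> simp [isoVec, h0, sub_eq_zero.mp h, mul_comm]

theorem mkP_eq_isoVec (hC : ∀ i, IsUnit (Cs i).det) {i : Fin n} {w : Fin 3 → ℂ} (hw : w ≠ 0)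
    (h0 : w 0 = 0) (h : w 1 ^ 2 + w 2 ^ 2 = 0) :
    ∃ s, mkP ((Cs i).mulVec w) = mkP ((Cs i).mulVec (isoVec s)) := by
  obtain ⟨s, hs⟩ := exists_eq_smul_isoVec h0 h
  exact ⟨s, (mkP_mulVec_eq_iff (hC i) hw (isoVec_ne_zero s)).mpr ⟨_, hs⟩⟩

theorem HQ_at_infinity (hC : ∀ i, IsUnit (Cs i).det) {β : Fin (2 * n + 1) → ℂ} {P : Fin n → P2}
    (hP : P ∈ HQ Cs β) {i : Fin n} (hi : P i ∈ infLine (Cs i)) :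
    (∃ s, P i = mkP ((Cs i).mulVec (isoVec s))) ∨ ∃ j, j ≠ i ∧ P j ∈ infLine (Cs j) := by
  obtain ⟨w, hw, hPw, hF⟩ := HQ_subset hC β hP
  rw [hPw, mkP_mem_infLine_iff (hC i) (hw i)] at hi
  have h1 : quadForm β w = quadTerm β i (w i) * ∏ j ∈ Finset.univ.erase i, w j 0 ^ 2 := by
    rw [quadForm, Finset.prod_eq_zero (Finset.mem_univ i) (by simp [hi]), mul_zero, add_zero]
    refine Finset.sum_eq_single i (fun j _ hj => ?_) (by simp)
    rw [Finset.prod_eq_zero (i := i) (by simp [hj.symm]) (by simp [hi]), mul_zero]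
  rw [h1] at hF
  rcases mul_eq_zero.mp hF with h | h
  · left
    have h : w i 1 ^ 2 + w i 2 ^ 2 = 0 := by
      simpa [quadTerm, hi, Fin.sum_univ_two] using h
    rw [hPw]
    exact mkP_eq_isoVec hC (hw i) hi h
  · right
    obtain ⟨j, hj, h⟩ := Finset.prod_eq_zero_iff.mp h
    refine ⟨j, Finset.ne_of_mem_erase hj, ?_⟩
    rw [hPw, mkP_mem_infLine_iff (hC j) (hw j)]
    simpa using h

theorem mem_HQ_of_tendsto {β : Fin (2 * n + 1) → ℂ} {P : Fin n → P2} (U : ℂ → Fin n → Fin 2 → ℂ)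
    (hQ : ∀ ε : ℂ, ε ≠ 0 → ∑ i, quadTerm β i (affLift (U ε i)) + β 0 = 0)
    (hU : ∀ i, Tendsto (fun ε => mkP ((Cs i).mulVec (affLift (U ε i)))) (𝓝[≠] 0) (𝓝 (P i))) :
    P ∈ HQ Cs β := by
  refine mem_closure_of_tendsto (tendsto_pi_nhds.mpr hU) ?_
  filter_upwards [self_mem_nhdsWithin] with ε hε
  obtain ⟨z, hz⟩ := exists_camCoord_eq (U ε)
  refine ⟨z, ?_, ?_⟩
  · rw [mem_quadSet_iff]
    simp only [hz]
    exact hQ ε hε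
  · funext i
    rw [chartMapN, hz]

theorem tendsto_mkP_affLift {Cm : Matrix (Fin 3) (Fin 3) ℂ} (hC : IsUnit Cm.det)
    {w : Fin 3 → ℂ} (hw : w ≠ 0) {u : ℂ → Fin 2 → ℂ} (c : ℂ → ℂ) (hc : ∀ ε, ε ≠ 0 → c ε ≠ 0)
    (g : ℂ → Fin 3 → ℂ) (hg : Continuous g) (hg0 : g 0 = w)
    (h : ∀ ε, ε ≠ 0 → c ε • affLift (u ε) = g ε) :
    Tendsto (fun ε => mkP (Cm.mulVec (affLift (u ε)))) (𝓝[≠] 0) (𝓝 (mkP (Cm.mulVec w))) := by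
  have h1 : Continuous fun ε => Cm.mulVec (g ε) := Continuous.matrix_mulVec continuous_const hg
  have h2 := ((continuousAt_mkP (mulVec_ne_zero hC hw)).tendsto.comp
    (hg0 ▸ h1.tendsto 0)).mono_left (nhdsWithin_le_nhds (s := {0}ᶜ))
  refine h2.congr' ?_
  filter_upwards [self_mem_nhdsWithin] with ε hε
  rw [Function.comp_apply, ← h ε hε, Matrix.mulVec_smul,
    mkP_smul (hc ε hε) (mulVec_ne_zero hC (affLift_ne_zero _))]

theorem affLift_eq (u : Fin 2 → ℂ) : affLift u = ![1, u 0, u 1] := by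
  funext i
  fin_cases i <;> rfl

theorem exists_tendsto_affine {Cm : Matrix (Fin 3) (Fin 3) ℂ} (hC : IsUnit Cm.det) (p : P2) :
    ∃ u : ℂ → Fin 2 → ℂ,
      Tendsto (fun ε => mkP (Cm.mulVec (affLift (u ε)))) (𝓝[≠] 0) (𝓝 p) := by
  obtain ⟨w, hw, rfl⟩ := exists_mkP_mulVec_eq hC p
  by_cases h0 : w 0 = 0
  · refine ⟨fun ε => ![w 1 / ε, w 2 / ε], tendsto_mkP_affLift hC hw (fun ε => ε) (fun _ h => h)
      (fun ε => ![ε, w 1, w 2]) (by fun_prop) ?_ ?_⟩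
    · funext i
      fin_cases i <;> simp [h0]
    · intro ε hε
      funext i
      fin_cases i <;> simp [affLift_eq] <;> field_simp
  · refine ⟨fun ε => ![w 1 / w 0, w 2 / w 0], tendsto_mkP_affLift hC hw (fun _ => w 0)
      (fun _ _ => h0) (fun _ => w) continuous_const rfl ?_⟩
    intro ε hε
    funext i
    fin_cases i <;> simp [affLift_eq] <;> field_simp

theorem quadTerm_affLift (β : Fin (2 * n + 1) → ℂ) (i : Fin n) (u : Fin 2 → ℂ) :
    quadTerm β i (affLift u) = (u 0 - camCoord n (fun m => β m.succ) i 0) ^ 2 +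
      (u 1 - camCoord n (fun m => β m.succ) i 1) ^ 2 := by
  simp [quadTerm, affLift, Fin.sum_univ_two]

theorem mem_HQ_of_isotropic (hC : ∀ i, IsUnit (Cs i).det) {β : Fin (2 * n + 1) → ℂ}
    {P : Fin n → P2} {i : Fin n} {s : Bool} (hi : P i = mkP ((Cs i).mulVec (isoVec s))) :
    P ∈ HQ Cs β := by
  classical
  choose u hu using fun k => exists_tendsto_affine (hC k) (P k)
  refine isClosed_closure.mem_of_tendsto (b := 𝓝[≠] (0 : ℂ))
    (f := fun ε k => if k = i then P i else mkP ((Cs k).mulVec (affLift (u k ε)))) ?_ ?_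
  · refine tendsto_pi_nhds.mpr fun k => ?_
    by_cases hk : k = i
    · subst hk; simp
    · simpa [hk] using hu k
  refine Eventually.of_forall fun δ => ?_
  set b := camCoord n (fun m => β m.succ) i with hb
  set K := ∑ k ∈ Finset.univ.erase i, quadTerm β k (affLift (u k δ)) + β 0 with hK
  have hs := sgn_mul_self s
  refine mem_HQ_of_tendsto (fun ε k => if k = i then
    ![(ε⁻¹ - K * ε) / 2 + b 0, sgn s * (ε⁻¹ + K * ε) / 2 + b 1] else u k δ) ?_ ?_
  · intro ε hε
    rw [← Finset.add_sum_erase _ _ (Finset.mem_univ i), add_assoc]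
    have : ∑ k ∈ Finset.univ.erase i, quadTerm β k (affLift (if k = i then
        ![(ε⁻¹ - K * ε) / 2 + b 0, sgn s * (ε⁻¹ + K * ε) / 2 + b 1] else u k δ)) + β 0 = K := by
      rw [hK]
      congr 1
      refine Finset.sum_congr rfl fun k hk => ?_
      rw [if_neg (Finset.ne_of_mem_erase hk)]
    rw [this, if_pos rfl, quadTerm_affLift, ← hb]
    simp only [Matrix.cons_val_zero, Matrix.cons_val_one, add_sub_cancel_right]
    have he : ε⁻¹ * ε = 1 := inv_mul_cancel₀ hε
    linear_combination ((ε⁻¹ + K * ε) / 2) ^ 2 * hs - K * he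
  · intro k
    by_cases hk : k = i
    · subst hk
      simp only [if_true, hi]
      refine tendsto_mkP_affLift (hC k) (isoVec_ne_zero s) (fun ε => 2 * ε)
        (fun ε hε => mul_ne_zero two_ne_zero hε)
        (fun ε => ![2 * ε, 1 - K * ε ^ 2 + 2 * ε * b 0, sgn s * (1 + K * ε ^ 2) + 2 * ε * b 1])
        (by fun_prop) ?_ ?_
      · funext j
        fin_cases j <;> simp [isoVec]
      · intro ε hε
        funext j
        fin_cases j <;> simp [affLift_eq] <;> field_simp
    · simp [hk]

theorem mem_HQ_of_infLine (hC : ∀ i, IsUnit (Cs i).det) {β : Fin (2 * n + 1) → ℂ}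
    {P : Fin n → P2} {i j : Fin n} (hij : i ≠ j) (hi : P i ∈ infLine (Cs i))
    (hj : P j ∈ infLine (Cs j)) : P ∈ HQ Cs β := by
  classical
  obtain ⟨w, hw, hw0, hPw⟩ := hi
  obtain ⟨w', hw', hw0', hPw'⟩ := hj
  by_cases hq : w 1 ^ 2 + w 2 ^ 2 = 0
  · obtain ⟨s, hs⟩ := mkP_eq_isoVec hC (i := i) hw hw0 hq
    exact mem_HQ_of_isotropic hC (hPw.trans hs)
  by_cases hq' : w' 1 ^ 2 + w' 2 ^ 2 = 0
  · obtain ⟨s, hs⟩ := mkP_eq_isoVec hC (i := j) hw' hw0' hq'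
    exact mem_HQ_of_isotropic hC (hPw'.trans hs)
  obtain ⟨μ, hμ⟩ := IsAlgClosed.exists_pow_nat_eq (w 1 ^ 2 + w 2 ^ 2) (n := 2) (by norm_num)
  obtain ⟨ν, hν⟩ := IsAlgClosed.exists_pow_nat_eq (w' 1 ^ 2 + w' 2 ^ 2) (n := 2) (by norm_num)
  have hμ0 : μ ≠ 0 := by rintro rfl; exact hq (by rw [← hμ]; ring)
  have hν0 : ν ≠ 0 := by rintro rfl; exact hq' (by rw [← hν]; ring)
  choose u hu using fun k => exists_tendsto_affine (hC k) (P k)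
  refine isClosed_closure.mem_of_tendsto (b := 𝓝[≠] (0 : ℂ)) (f := fun ε k => if k = i then P i else
    if k = j then P j else mkP ((Cs k).mulVec (affLift (u k ε)))) ?_ ?_
  · refine tendsto_pi_nhds.mpr fun k => ?_
    by_cases hk : k = i
    · subst hk; simp
    by_cases hk' : k = j
    · subst hk'; simp [hk]
    · simpa [hk, hk'] using hu k
  refine Eventually.of_forall fun δ => ?_
  set b := camCoord n (fun m => β m.succ) i with hb
  set b' := camCoord n (fun m => β m.succ) j with hb'
  set K := ∑ k ∈ (Finset.univ.erase i).erase j, quadTerm β k (affLift (u k δ)) + β 0 with hK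
  let S : ℂ → ℂ := fun ε => (ε⁻¹ - K * ε) / (2 * μ)
  let T : ℂ → ℂ := fun ε => Complex.I * (ε⁻¹ + K * ε) / (2 * ν)
  let U : ℂ → Fin n → Fin 2 → ℂ := fun ε k => if k = i then
    ![S ε * w 1 + b 0, S ε * w 2 + b 1] else if k = j then
    ![T ε * w' 1 + b' 0, T ε * w' 2 + b' 1] else u k δ
  have hUi : ∀ ε, U ε i = ![S ε * w 1 + b 0, S ε * w 2 + b 1] := fun ε => if_pos rfl
  have hUj : ∀ ε, U ε j = ![T ε * w' 1 + b' 0, T ε * w' 2 + b' 1] := fun ε => by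
    simp [U, hij.symm]
  have hUk : ∀ ε k, k ≠ i → k ≠ j → U ε k = u k δ := fun ε k h h' => by simp [U, h, h']
  refine mem_HQ_of_tendsto U ?_ ?_
  · intro ε hε
    rw [← Finset.add_sum_erase _ _ (Finset.mem_univ i),
      ← Finset.add_sum_erase _ _ (Finset.mem_erase.mpr ⟨hij.symm, Finset.mem_univ j⟩), add_assoc,
      add_assoc]
    have : ∑ k ∈ (Finset.univ.erase i).erase j, quadTerm β k (affLift (U ε k)) + β 0 = K := by
      rw [hK]
      congr 1
      refine Finset.sum_congr rfl fun k hk => ?_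
      rw [hUk _ _ (Finset.ne_of_mem_erase (Finset.mem_of_mem_erase hk)) (Finset.ne_of_mem_erase hk)]
    rw [this, hUi, hUj, quadTerm_affLift, quadTerm_affLift, ← hb, ← hb']
    simp only [Matrix.cons_val_zero, Matrix.cons_val_one, add_sub_cancel_right]
    have he : ε⁻¹ * ε = 1 := inv_mul_cancel₀ hε
    have h1 : S ε ^ 2 * μ ^ 2 = ((ε⁻¹ - K * ε) / 2) ^ 2 := by
      simp only [S]; field_simp
    have h2 : T ε ^ 2 * ν ^ 2 = -((ε⁻¹ + K * ε) / 2) ^ 2 := by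
      have : T ε * ν = Complex.I * ((ε⁻¹ + K * ε) / 2) := by simp only [T]; field_simp
      rw [← mul_pow, this, mul_pow, Complex.I_sq]; ring
    linear_combination h1 + h2 - K * he - S ε ^ 2 * hμ - T ε ^ 2 * hν
  · intro k
    by_cases hk : k = i
    · subst hk
      simp only [hUi, if_true, hPw]
      refine tendsto_mkP_affLift (hC k) hw (fun ε => 2 * μ * ε)
        (fun ε hε => mul_ne_zero (mul_ne_zero two_ne_zero hμ0) hε)
        (fun ε => ![2 * μ * ε, (1 - K * ε ^ 2) * w 1 + 2 * μ * ε * b 0,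
          (1 - K * ε ^ 2) * w 2 + 2 * μ * ε * b 1])
        (by fun_prop) ?_ ?_
      · funext j
        fin_cases j <;> simp [hw0]
      · intro ε hε
        funext j
        fin_cases j <;> simp [affLift_eq, S] <;> field_simp
    by_cases hk' : k = j
    · subst hk'
      simp only [hUj, hk, if_true, if_false, hPw']
      refine tendsto_mkP_affLift (hC k) hw' (fun ε => -(2 * ν * Complex.I * ε))
        (fun ε hε => neg_ne_zero.mpr
          (mul_ne_zero (mul_ne_zero (mul_ne_zero two_ne_zero hν0) Complex.I_ne_zero) hε))
        (fun ε => ![-(2 * ν * Complex.I * ε),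
          (1 + K * ε ^ 2) * w' 1 - 2 * ν * Complex.I * ε * b' 0,
          (1 + K * ε ^ 2) * w' 2 - 2 * ν * Complex.I * ε * b' 1])
        (by fun_prop) ?_ ?_
      · funext j
        fin_cases j <;> simp [hw0']
      · have hT : ∀ ε, ε ≠ 0 → -(2 * ν * Complex.I * ε) * T ε = 1 + K * ε ^ 2 := by
          intro ε hε
          simp only [T]
          field_simp
          linear_combination -(1 + K * ε ^ 2) * Complex.I_sq
        intro ε hε
        funext j
        fin_cases j
        · simp [affLift_eq]
        · simp [affLift_eq]
          linear_combination w' 1 * hT ε hε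
        · simp [affLift_eq]
          linear_combination w' 2 * hT ε hε
    · simp [hk, hk', hUk]

end

noncomputable section

open scoped Manifold Topology
open Filter

/-! ### The curves at infinity of the quadric divisor -/

variable {n : ℕ} {A : Fin n → Matrix (Fin 3) (Fin 4) ℂ} {Cs : Fin n → Matrix (Fin 3) (Fin 3) ℂ}

theorem exists_ne_zero_of_surjective_prod {φ : (Fin 4 → ℂ) →ₗ[ℂ] ℂ × ℂ}
    (hφ : Function.Surjective φ) {y : Fin 4 → ℂ} (hy : y ≠ 0) (hφy : φ y = 0) :
    ∃ x, φ x = 0 ∧ (∀ s t : ℂ, s • x + t • y = 0 → s = 0 ∧ t = 0) ∧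
      ∀ w, φ w = 0 → ∃ s t : ℂ, w = s • x + t • y := by
  have hfin : Module.finrank ℂ (LinearMap.ker φ) = 2 := by
    have := LinearMap.finrank_range_add_finrank_ker φ
    rw [LinearMap.range_eq_top.mpr hφ, finrank_top] at this
    simp at this
    omega
  obtain ⟨x, hx⟩ : ∃ x : LinearMap.ker φ,
      x ∉ Submodule.span ℂ {(⟨y, hφy⟩ : LinearMap.ker φ)} := by
    by_contra! h
    have h1 : Submodule.span ℂ {(⟨y, hφy⟩ : LinearMap.ker φ)} = ⊤ := by
      rw [eq_top_iff]; exact fun x _ => h x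
    have := finrank_span_singleton (K := ℂ) (v := (⟨y, hφy⟩ : LinearMap.ker φ))
      (by simpa [Subtype.ext_iff] using hy)
    rw [h1, finrank_top, hfin] at this
    omega
  have hind : ∀ s t : ℂ, s • x.1 + t • y = 0 → s = 0 ∧ t = 0 := by
    intro s t hst
    have hs : s = 0 := by
      by_contra hs
      refine hx (Submodule.mem_span_singleton.mpr ⟨-(s⁻¹ * t), Subtype.ext ?_⟩)
      have : x.1 = s⁻¹ • (s • x.1) := by rw [smul_smul, inv_mul_cancel₀ hs, one_smul]
      rw [this, eq_neg_of_add_eq_zero_left hst]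
      simp [smul_smul]
    subst hs
    refine ⟨rfl, ?_⟩
    simpa [hy] using hst
  refine ⟨x.1, x.2, hind, fun w hw => ?_⟩
  have hli : LinearIndependent ℂ ![x, (⟨y, hφy⟩ : LinearMap.ker φ)] := by
    rw [LinearIndependent.pair_iff]
    intro s t hst
    exact hind s t (by simpa using congrArg Subtype.val hst)
  have htop := hli.span_eq_top_of_card_eq_finrank (by simp [hfin])
  have : (⟨w, hw⟩ : LinearMap.ker φ) ∈ Submodule.span ℂ (Set.range ![x, ⟨y, hφy⟩]) := by
    rw [htop]; trivial
  rw [Matrix.range_cons, Matrix.range_cons, Matrix.range_empty, Set.union_empty,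
    Set.singleton_union, Submodule.mem_span_pair] at this
  obtain ⟨s, t, hst⟩ := this
  exact ⟨s, t, (by simpa using congrArg Subtype.val hst.symm)⟩

theorem isSphere_of_plane {φ : (Fin 4 → ℂ) →ₗ[ℂ] ℂ × ℂ} (hφ : Function.Surjective φ)
    {T : Fin n → Prop} (hT : ∃ k, T k)
    (hA : ∀ k, T k → ∀ y, φ y = 0 → (A k).mulVec y = 0 → y = 0)
    {p₀ : Fin n → P2} {S : Set (Fin n → P2)}
    (hS : ∀ P, P ∈ S ↔ ∃ y, y ≠ 0 ∧ φ y = 0 ∧ (∀ k, T k → P k = mkP ((A k).mulVec y)) ∧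
      ∀ k, ¬ T k → P k = p₀ k) : IsSphere S := by
  classical
  constructor
  · have : 0 < Module.finrank ℂ (LinearMap.ker φ) := by
      have := LinearMap.finrank_range_add_finrank_ker φ
      rw [LinearMap.range_eq_top.mpr hφ, finrank_top] at this
      simp at this
      omega
    have := Module.nontrivial_of_finrank_pos this
    obtain ⟨y, hy⟩ := exists_ne (0 : LinearMap.ker φ)
    exact ⟨fun k => if T k then mkP ((A k).mulVec y.1) else p₀ k, (hS _).mpr ⟨y.1,
      fun h => hy (Subtype.ext h), y.2, fun k hk => if_pos hk, fun k hk => if_neg hk⟩⟩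
  · intro P hP
    obtain ⟨y, hy, hφy, hP1, hP2⟩ := (hS P).mp hP
    obtain ⟨x, hφx, hind, hspan⟩ := exists_ne_zero_of_surjective_prod hφ hy hφy
    have hφc : ∀ s t : ℂ, φ (s • x + t • y) = 0 := fun s t => by simp [hφx, hφy]
    have hlin : ∀ k, ∀ s t : ℂ, (A k).mulVec (s • x + t • y) =
        s • (A k).mulVec x + t • (A k).mulVec y := fun k s t => by
      rw [Matrix.mulVec_add, Matrix.mulVec_smul, Matrix.mulVec_smul]
    have hindA : ∀ k, T k → ∀ s t : ℂ, s • (A k).mulVec x + t • (A k).mulVec y = 0 →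
        s = 0 ∧ t = 0 := fun k hk s t h =>
      hind s t (hA k hk _ (hφc s t) (by rw [hlin, h]))
    refine ⟨fun z k => if T k then lineMap ((A k).mulVec x) ((A k).mulVec y) z else p₀ k,
      ?_, ?_, ?_, ?_⟩
    · refine continuous_pi fun k => ?_
      by_cases hk : T k
      · simp only [hk, if_true]
        refine continuous_lineMap (fun h => ?_) fun z h => ?_
        · simpa using (hindA k hk 0 1 (by simp [h])).2
        · simpa using (hindA k hk 1 z (by simpa using h)).1
      · simp only [hk, if_false]
        exact continuous_const
    · obtain ⟨k, hk⟩ := hT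
      intro z w hzw
      have := congrFun hzw k
      simp only [hk, if_true] at this
      exact lineMap_injective (hindA k hk) this
    · apply Set.Subset.antisymm
      · rintro _ ⟨z, rfl⟩
        rw [hS]
        induction z using OnePoint.rec with
        | infty => exact ⟨y, hy, hφy, fun k hk => if_pos hk, fun k hk => if_neg hk⟩
        | coe z =>
          refine ⟨(1 : ℂ) • x + z • y, fun h => by simpa using (hind 1 z h).1, hφc 1 z,
            fun k hk => ?_, fun k hk => if_neg hk⟩
          rw [hlin, one_smul]
          exact if_pos hk
      · intro Q hQ
        obtain ⟨w, hw, hφw, hQ1, hQ2⟩ := (hS Q).mp hQ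
        obtain ⟨s, t, rfl⟩ := hspan w hφw
        by_cases hs : s = 0
        · subst hs
          refine ⟨OnePoint.infty, funext fun k => ?_⟩
          have ht : t ≠ 0 := by rintro rfl; simp at hw
          by_cases hk : T k
          · simp only [hk, if_true]
            have : (A k).mulVec y ≠ 0 := fun h => by simpa using (hindA k hk 0 1 (by simp [h])).2
            rw [hQ1 k hk, hlin, zero_smul, zero_add, mkP_smul ht this]
            rfl
          · simp only [hk, if_false, hQ2 k hk]
        · refine ⟨((t / s : ℂ) : OnePoint ℂ), funext fun k => ?_⟩
          by_cases hk : T k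
          · simp only [hk, if_true]
            have : (A k).mulVec x + (t / s) • (A k).mulVec y ≠ 0 := fun h => by
              simpa using (hindA k hk 1 (t / s) (by simpa using h)).1
            have h2 : s • (A k).mulVec x + t • (A k).mulVec y =
                s • ((A k).mulVec x + (t / s) • (A k).mulVec y) := by
              rw [smul_add, smul_smul, mul_div_cancel₀ _ hs]
            rw [hQ1 k hk, hlin, h2, mkP_smul hs this]
            rfl
          · simp only [hk, if_false, hQ2 k hk]
    · funext k
      by_cases hk : T k
      · simp only [hk, if_true, hP1 k hk]; rfl
      · simp only [hk, if_false, hP2 k hk]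

/-- The equation of the plane which the camera `Am` maps to the line at infinity of the
chart `Cm`. -/
def planeForm (Am : Matrix (Fin 3) (Fin 4) ℂ) (Cm : Matrix (Fin 3) (Fin 3) ℂ) :
    (Fin 4 → ℂ) →ₗ[ℂ] ℂ :=
  LinearMap.proj 0 ∘ₗ (Cm.adjugate * Am).mulVecLin

theorem planeForm_apply (Am : Matrix (Fin 3) (Fin 4) ℂ) (Cm : Matrix (Fin 3) (Fin 3) ℂ)
    (y : Fin 4 → ℂ) : planeForm Am Cm y = Cm.adjugate.mulVec (Am.mulVec y) 0 := by
  simp [planeForm]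

/-- The line of world points which the camera `Am` maps to a circular point of the
chart `Cm`. -/
def isoLine (Am : Matrix (Fin 3) (Fin 4) ℂ) (Cm : Matrix (Fin 3) (Fin 3) ℂ) (s : Bool) :
    Set (Fin 4 → ℂ) :=
  {y | ∃ t : ℂ, Am.mulVec y = t • Cm.mulVec (isoVec s)}

theorem adjugate_mulVec_mulVec (Cm : Matrix (Fin 3) (Fin 3) ℂ) (w : Fin 3 → ℂ) :
    Cm.adjugate.mulVec (Cm.mulVec w) = Cm.det • w := by
  rw [Matrix.mulVec_mulVec, Matrix.adjugate_mul, Matrix.smul_mulVec, Matrix.one_mulVec]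

theorem mulVec_adjugate_mulVec (Cm : Matrix (Fin 3) (Fin 3) ℂ) (w : Fin 3 → ℂ) :
    Cm.mulVec (Cm.adjugate.mulVec w) = Cm.det • w := by
  rw [Matrix.mulVec_mulVec, Matrix.mul_adjugate, Matrix.smul_mulVec, Matrix.one_mulVec]

theorem mkP_mem_infLine_iff_planeForm {Am : Matrix (Fin 3) (Fin 4) ℂ}
    {Cm : Matrix (Fin 3) (Fin 3) ℂ} (hC : IsUnit Cm.det) {y : Fin 4 → ℂ} (hy : Am.mulVec y ≠ 0) :
    mkP (Am.mulVec y) ∈ infLine Cm ↔ planeForm Am Cm y = 0 := by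
  have hd : Cm.det ≠ 0 := hC.ne_zero
  have h1 : Am.mulVec y = Cm.mulVec (Cm.det⁻¹ • Cm.adjugate.mulVec (Am.mulVec y)) := by
    rw [Matrix.mulVec_smul, mulVec_adjugate_mulVec, smul_smul, inv_mul_cancel₀ hd, one_smul]
  have h2 : Cm.det⁻¹ • Cm.adjugate.mulVec (Am.mulVec y) ≠ 0 := fun h => hy (by rw [h1, h]; simp)
  rw [h1, mkP_mem_infLine_iff hC h2, planeForm_apply]
  simp [hd]

theorem planeForm_eq_zero_of_mem_isoLine {Am : Matrix (Fin 3) (Fin 4) ℂ}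
    {Cm : Matrix (Fin 3) (Fin 3) ℂ} {s : Bool} {y : Fin 4 → ℂ} (hy : y ∈ isoLine Am Cm s) :
    planeForm Am Cm y = 0 := by
  obtain ⟨t, ht⟩ := hy
  rw [planeForm_apply, ht, Matrix.mulVec_smul, adjugate_mulVec_mulVec]
  simp [isoVec]

/-- Two linear forms cutting out `isoLine`. -/
def isoForm (Am : Matrix (Fin 3) (Fin 4) ℂ) (Cm : Matrix (Fin 3) (Fin 3) ℂ) (s : Bool) :
    (Fin 4 → ℂ) →ₗ[ℂ] ℂ × ℂ :=
  (planeForm Am Cm).prod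
    ((LinearMap.proj 2 - sgn s • LinearMap.proj 1) ∘ₗ (Cm.adjugate * Am).mulVecLin)

theorem isoForm_eq_zero_iff {Am : Matrix (Fin 3) (Fin 4) ℂ}
    {Cm : Matrix (Fin 3) (Fin 3) ℂ} (hC : IsUnit Cm.det) {s : Bool} {y : Fin 4 → ℂ} :
    isoForm Am Cm s y = 0 ↔ y ∈ isoLine Am Cm s := by
  have hd : Cm.det ≠ 0 := hC.ne_zero
  constructor
  · intro h
    have h1 : Cm.adjugate.mulVec (Am.mulVec y) 0 = 0 := by
      rw [← planeForm_apply]; exact congrArg Prod.fst h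
    have h2 : Cm.adjugate.mulVec (Am.mulVec y) 2 =
        sgn s * Cm.adjugate.mulVec (Am.mulVec y) 1 := by
      have := congrArg Prod.snd h
      simpa [isoForm, sub_eq_zero] using this
    refine ⟨Cm.det⁻¹ * Cm.adjugate.mulVec (Am.mulVec y) 1, ?_⟩
    have h3 : Cm.adjugate.mulVec (Am.mulVec y) =
        Cm.adjugate.mulVec (Am.mulVec y) 1 • isoVec s := by
      funext k
      fin_cases k
      · simpa [isoVec] using h1
      · simp [isoVec]
      · simpa [isoVec, mul_comm] using h2
    rw [mul_smul, ← Matrix.mulVec_smul, ← h3, mulVec_adjugate_mulVec, smul_smul,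
      inv_mul_cancel₀ hd, one_smul]
  · rintro ⟨t, ht⟩
    have : Cm.adjugate.mulVec (Am.mulVec y) = (t * Cm.det) • isoVec s := by
      rw [ht, Matrix.mulVec_smul, adjugate_mulVec_mulVec, smul_smul]
    refine Prod.ext ?_ ?_
    · simp [isoForm, planeForm_apply, this, isoVec]
    · simp [isoForm, this, isoVec]
      ring

theorem isoForm_surjective {Am : Matrix (Fin 3) (Fin 4) ℂ}
    {Cm : Matrix (Fin 3) (Fin 3) ℂ} (hC : IsUnit Cm.det) (hA : Function.Surjective Am.mulVec)
    (s : Bool) : Function.Surjective (isoForm Am Cm s) := by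
  have hd : Cm.det ≠ 0 := hC.ne_zero
  rintro ⟨a, b⟩
  obtain ⟨y, hy⟩ := hA (Cm.mulVec (Cm.det⁻¹ • ![a, 0, b]))
  refine ⟨y, ?_⟩
  have : Cm.adjugate.mulVec (Am.mulVec y) = ![a, 0, b] := by
    rw [hy, adjugate_mulVec_mulVec, smul_smul, mul_inv_cancel₀ hd, one_smul]
  refine Prod.ext ?_ ?_
  · simp [isoForm, planeForm_apply, this]
  · simp [isoForm, this]

theorem exists_ne_zero_map_eq_zero {W : Type} [AddCommGroup W] [Module ℂ W] [Module.Finite ℂ W]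
    (hW : Module.finrank ℂ W < 4) (f : (Fin 4 → ℂ) →ₗ[ℂ] W) : ∃ y, y ≠ 0 ∧ f y = 0 := by
  have := LinearMap.ker_ne_bot_of_finrank_lt (f := f) (by simpa using hW)
  obtain ⟨y, hy, h0⟩ := (Submodule.ne_bot_iff _).mp this
  exact ⟨y, h0, hy⟩

/-- The genericity conditions on cameras and charts. -/
structure GoodConfig (A : Fin n → Matrix (Fin 3) (Fin 4) ℂ)
    (Cs : Fin n → Matrix (Fin 3) (Fin 3) ℂ) : Prop where
  det : ∀ i, IsUnit (Cs i).det
  surj : ∀ i, Function.Surjective (A i).mulVec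
  plane_center : ∀ i j, i ≠ j → ∀ y, planeForm (A i) (Cs i) y = 0 → (A j).mulVec y = 0 → y = 0
  iso_iso : ∀ i j, i ≠ j → ∀ s t, ∀ y ∈ isoLine (A i) (Cs i) s, y ∈ isoLine (A j) (Cs j) t → y = 0
  four_planes : ∀ i j k l, i ≠ j → i ≠ k → i ≠ l → j ≠ k → j ≠ l → k ≠ l → ∀ y,
    planeForm (A i) (Cs i) y = 0 → planeForm (A j) (Cs j) y = 0 →
    planeForm (A k) (Cs k) y = 0 → planeForm (A l) (Cs l) y = 0 → y = 0
  three_planes : ∀ i j k, i ≠ j → i ≠ k → j ≠ k → ∀ y y', y ≠ 0 →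
    planeForm (A i) (Cs i) y = 0 → planeForm (A j) (Cs j) y = 0 → planeForm (A k) (Cs k) y = 0 →
    planeForm (A i) (Cs i) y' = 0 → planeForm (A j) (Cs j) y' = 0 →
    planeForm (A k) (Cs k) y' = 0 → ∃ c : ℂ, y' = c • y
  iso_planes : ∀ i j k, i ≠ j → i ≠ k → j ≠ k → ∀ s, ∀ y ∈ isoLine (A i) (Cs i) s,
    planeForm (A j) (Cs j) y = 0 → planeForm (A k) (Cs k) y = 0 → y = 0

/-- The points of `D_∞` whose `i`-th factor is a circular point. -/
def isoCurve (A : Fin n → Matrix (Fin 3) (Fin 4) ℂ) (Cs : Fin n → Matrix (Fin 3) (Fin 3) ℂ)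
    (i : Fin n) (s : Bool) : Set (Fin n → P2) :=
  mvVariety A ∩ {P | P i = mkP ((Cs i).mulVec (isoVec s))}

/-- `D_{∞,i} ∩ D_{∞,j}`. -/
def infCurve (A : Fin n → Matrix (Fin 3) (Fin 4) ℂ) (Cs : Fin n → Matrix (Fin 3) (Fin 3) ℂ)
    (i j : Fin n) : Set (Fin n → P2) :=
  mvVariety A ∩ {P | P i ∈ infLine (Cs i) ∧ P j ∈ infLine (Cs j)}

theorem infCurve_comm (i j : Fin n) : infCurve A Cs i j = infCurve A Cs j i := by
  ext P
  simp only [infCurve, Set.mem_inter_iff, Set.mem_ofPred_eq]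
  tauto

theorem isoVec_mem_infLine (Cm : Matrix (Fin 3) (Fin 3) ℂ) (s : Bool) :
    mkP (Cm.mulVec (isoVec s)) ∈ infLine Cm :=
  ⟨isoVec s, isoVec_ne_zero s, rfl, rfl⟩

theorem DQ_inter_DinfAll_eq (hC : ∀ i, IsUnit (Cs i).det) (β : Fin (2 * n + 1) → ℂ) :
    DQ A Cs β ∩ DinfAll A Cs =
      (⋃ p : Fin n × Bool, isoCurve A Cs p.1 p.2) ∪
        {P | ∃ i j, i < j ∧ P ∈ infCurve A Cs i j} := by
  ext P
  constructor
  · rintro ⟨⟨hY, hQ⟩, -, hinf⟩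
    obtain ⟨i, hi⟩ := Set.mem_iUnion.mp hinf
    rcases HQ_at_infinity hC hQ hi with ⟨s, hs⟩ | ⟨j, hji, hj⟩
    · exact Or.inl (Set.mem_iUnion.mpr ⟨(i, s), hY, hs⟩)
    · right
      rcases lt_or_gt_of_ne hji with h | h
      · exact ⟨j, i, h, hY, hj, hi⟩
      · exact ⟨i, j, h, hY, hi, hj⟩
  · rintro (h | ⟨i, j, hij, hY, hi, hj⟩)
    · obtain ⟨⟨i, s⟩, hY, hs⟩ := Set.mem_iUnion.mp h
      refine ⟨⟨hY, mem_HQ_of_isotropic hC hs⟩, hY, Set.mem_iUnion.mpr ⟨i, ?_⟩⟩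
      have hs' : P i = mkP ((Cs i).mulVec (isoVec s)) := hs
      change P i ∈ infLine (Cs i)
      rw [hs']
      exact isoVec_mem_infLine _ _
    · exact ⟨⟨hY, mem_HQ_of_infLine hC hij.ne hi hj⟩, hY, Set.mem_iUnion.mpr ⟨i, hi⟩⟩

namespace GoodConfig

theorem mem_mvVariety (G : GoodConfig A Cs)
    {P : Fin n → P2} : P ∈ mvVariety A ↔ ∃ y, IsWitness A y P := by
  rw [mvVariety_eq G.surj fun i j y hij hi hj => G.plane_center i j hij y
    (by rw [planeForm_apply, hi]; simp) hj]
  rfl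

end GoodConfig

end

noncomputable section

open scoped Manifold Topology
open Filter

variable {n : ℕ} {A : Fin n → Matrix (Fin 3) (Fin 4) ℂ} {Cs : Fin n → Matrix (Fin 3) (Fin 3) ℂ}
namespace GoodConfig

theorem mulVec_iso_ne_zero (G : GoodConfig A Cs)
    (i : Fin n) (s : Bool) : (Cs i).mulVec (isoVec s) ≠ 0 :=
  mulVec_ne_zero (G.det i) (isoVec_ne_zero s)

theorem planeForm_eq_zero (G : GoodConfig A Cs)
    {P : Fin n → P2} {y : Fin 4 → ℂ} (h : IsWitness A y P) {i : Fin n}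
    (hi : P i ∈ infLine (Cs i)) : planeForm (A i) (Cs i) y = 0 := by
  obtain ⟨w, hw, hw0, hP⟩ := hi
  obtain ⟨t, ht⟩ := h.exists_eq_smul (mulVec_ne_zero (G.det i) hw) hP
  rw [planeForm_apply, ht, Matrix.mulVec_smul, adjugate_mulVec_mulVec]
  simp [hw0]

theorem mem_infCurve_iff (G : GoodConfig A Cs) {i j : Fin n} (hij : i ≠ j) {P : Fin n → P2} :
    P ∈ infCurve A Cs i j ↔ ∃ y, y ≠ 0 ∧ planeForm (A i) (Cs i) y = 0 ∧
      planeForm (A j) (Cs j) y = 0 ∧ (∀ k, (A k).mulVec y ≠ 0) ∧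
      ∀ k, P k = mkP ((A k).mulVec y) := by
  constructor
  · rintro ⟨hY, hi, hj⟩
    obtain ⟨y, hy⟩ := G.mem_mvVariety.mp hY
    have h1 := G.planeForm_eq_zero hy hi
    have h2 := G.planeForm_eq_zero hy hj
    have h3 : ∀ k, (A k).mulVec y ≠ 0 := fun k hk => by
      by_cases hik : i = k
      · exact hy.1 (G.plane_center j k (hik ▸ hij.symm) y h2 hk)
      · exact hy.1 (G.plane_center i k hik y h1 hk)
    exact ⟨y, hy.1, h1, h2, h3, fun k => hy.eq_mkP (h3 k)⟩
  · rintro ⟨y, hy, h1, h2, h3, hP⟩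
    refine ⟨G.mem_mvVariety.mpr ⟨y, hy, fun k => ⟨_, h3 k, hP k, 1, (one_smul _ _).symm⟩⟩, ?_, ?_⟩
    · rw [hP i]; exact (mkP_mem_infLine_iff_planeForm (G.det i) (h3 i)).mpr h1
    · rw [hP j]; exact (mkP_mem_infLine_iff_planeForm (G.det j) (h3 j)).mpr h2

theorem mulVec_ne_zero_of_planeForm (G : GoodConfig A Cs)
    {i j : Fin n} (hij : i ≠ j) {y : Fin 4 → ℂ} (hy : y ≠ 0)
    (h1 : planeForm (A i) (Cs i) y = 0) (h2 : planeForm (A j) (Cs j) y = 0) (k : Fin n) :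
    (A k).mulVec y ≠ 0 := fun hk => by
  by_cases hik : i = k
  · exact hy (G.plane_center j k (hik ▸ hij.symm) y h2 hk)
  · exact hy (G.plane_center i k hik y h1 hk)

theorem mem_isoCurve_iff (G : GoodConfig A Cs) {i : Fin n} {s : Bool} {P : Fin n → P2} :
    P ∈ isoCurve A Cs i s ↔ ∃ y, y ≠ 0 ∧ y ∈ isoLine (A i) (Cs i) s ∧
      (∀ k, k ≠ i → P k = mkP ((A k).mulVec y)) ∧ P i = mkP ((Cs i).mulVec (isoVec s)) := by
  constructor
  · rintro ⟨hY, hi⟩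
    obtain ⟨y, hy⟩ := G.mem_mvVariety.mp hY
    have h1 : y ∈ isoLine (A i) (Cs i) s := hy.exists_eq_smul (G.mulVec_iso_ne_zero i s) hi
    refine ⟨y, hy.1, h1, fun k hk => hy.eq_mkP fun h => hy.1 ?_, hi⟩
    exact G.plane_center i k hk.symm y (planeForm_eq_zero_of_mem_isoLine h1) h
  · rintro ⟨y, hy, h1, h2, hP⟩
    refine ⟨G.mem_mvVariety.mpr ⟨y, hy, fun k => ?_⟩, hP⟩
    by_cases hk : k = i
    · subst hk
      exact ⟨_, G.mulVec_iso_ne_zero k s, hP, h1⟩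
    · refine ⟨_, fun h => hy ?_, h2 k hk, 1, (one_smul _ _).symm⟩
      exact G.plane_center i k (Ne.symm hk) y (planeForm_eq_zero_of_mem_isoLine h1) h

theorem isSphere_infCurve (G : GoodConfig A Cs)
    {i j : Fin n} (hij : i ≠ j) : IsSphere (infCurve A Cs i j) := by
  have hφ : Function.Surjective ((planeForm (A i) (Cs i)).prod (planeForm (A j) (Cs j))) := by
    obtain ⟨c, hc, hci⟩ := exists_ne_zero_map_eq_zero (by simp) (A i).mulVecLin
    rw [Matrix.mulVecLin_apply] at hci
    obtain ⟨d, hd, hdj⟩ := exists_ne_zero_map_eq_zero (by simp) (A j).mulVecLin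
    rw [Matrix.mulVecLin_apply] at hdj
    have hci' : planeForm (A i) (Cs i) c = 0 := by rw [planeForm_apply, hci]; simp
    have hdj' : planeForm (A j) (Cs j) d = 0 := by rw [planeForm_apply, hdj]; simp
    have hcj : planeForm (A j) (Cs j) c ≠ 0 := fun h => hc (G.plane_center j i hij.symm c h hci)
    have hdi : planeForm (A i) (Cs i) d ≠ 0 := fun h => hd (G.plane_center i j hij d h hdj)
    rintro ⟨a, b⟩
    refine ⟨(b / planeForm (A j) (Cs j) c) • c + (a / planeForm (A i) (Cs i) d) • d, ?_⟩
    refine Prod.ext ?_ ?_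
    · simp [hci', hdi]
    · simp [hdj', hcj]
  refine isSphere_of_plane (A := A) hφ (T := fun _ => True) ⟨i, trivial⟩ (p₀ := fun _ => mkP 0)
    ?_ fun P => ?_
  · intro k _ y hy hk
    by_contra h0
    exact G.mulVec_ne_zero_of_planeForm hij h0 (congrArg Prod.fst hy) (congrArg Prod.snd hy) k hk
  · rw [G.mem_infCurve_iff hij]
    refine exists_congr fun y => ?_
    constructor
    · rintro ⟨h0, h1, h2, -, hP⟩
      exact ⟨h0, Prod.ext h1 h2, fun k _ => hP k, fun k hk => absurd trivial hk⟩
    · rintro ⟨h0, h12, hP, -⟩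
      exact ⟨h0, congrArg Prod.fst h12, congrArg Prod.snd h12,
        G.mulVec_ne_zero_of_planeForm hij h0 (congrArg Prod.fst h12) (congrArg Prod.snd h12),
        fun k => hP k trivial⟩

theorem isSphere_isoCurve (G : GoodConfig A Cs)
    (hn : 2 ≤ n) (i : Fin n) (s : Bool) : IsSphere (isoCurve A Cs i s) := by
  have : Nontrivial (Fin n) := Fin.nontrivial_iff_two_le.mpr hn
  refine isSphere_of_plane (A := A) (isoForm_surjective (G.det i) (G.surj i) s)
    (T := fun k => k ≠ i) (exists_ne i) (p₀ := fun _ => mkP ((Cs i).mulVec (isoVec s)))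
    ?_ fun P => ?_
  · intro k hk y hy h
    rw [isoForm_eq_zero_iff (G.det i)] at hy
    exact G.plane_center i k (Ne.symm hk) y (planeForm_eq_zero_of_mem_isoLine hy) h
  · simp only [G.mem_isoCurve_iff, isoForm_eq_zero_iff (G.det i), ne_eq, not_not, forall_eq]

theorem isoCurve_inter_isoCurve (G : GoodConfig A Cs)
    {i j : Fin n} {s t : Bool} (h : (i, s) ≠ (j, t)) {P : Fin n → P2}
    (hi : P ∈ isoCurve A Cs i s) (hj : P ∈ isoCurve A Cs j t) : False := by
  by_cases hij : i = j
  · subst hij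
    have h1 : mkP ((Cs i).mulVec (isoVec s)) = mkP ((Cs i).mulVec (isoVec t)) :=
      hi.2.symm.trans hj.2
    obtain ⟨c, hc⟩ := (mkP_mulVec_eq_iff (G.det i) (isoVec_ne_zero s) (isoVec_ne_zero t)).mp h1
    have e1 := congrFun hc 1
    have e2 := congrFun hc 2
    simp [isoVec] at e1 e2
    rw [← e1, one_mul] at e2
    exact h (by rw [sgn_injective e2])
  · obtain ⟨y, hy⟩ := G.mem_mvVariety.mp hi.1
    exact hy.1 (G.iso_iso i j hij s t y (hy.exists_eq_smul (G.mulVec_iso_ne_zero i s) hi.2)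
      (hy.exists_eq_smul (G.mulVec_iso_ne_zero j t) hj.2))

theorem isoCurve_inter_infLine (G : GoodConfig A Cs)
    {i j k : Fin n} (hij : i ≠ j) (hik : i ≠ k) (hjk : j ≠ k) {s : Bool}
    {P : Fin n → P2} (hi : P ∈ isoCurve A Cs i s) (hj : P j ∈ infLine (Cs j))
    (hk : P k ∈ infLine (Cs k)) : False := by
  obtain ⟨y, hy⟩ := G.mem_mvVariety.mp hi.1
  exact hy.1 (G.iso_planes i j k hij hik hjk s y
    (hy.exists_eq_smul (G.mulVec_iso_ne_zero i s) hi.2) (G.planeForm_eq_zero hy hj)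
    (G.planeForm_eq_zero hy hk))

theorem not_four_infLine (G : GoodConfig A Cs)
    {i j k l : Fin n} (hij : i ≠ j) (hik : i ≠ k) (hil : i ≠ l) (hjk : j ≠ k)
    (hjl : j ≠ l) (hkl : k ≠ l) {P : Fin n → P2} (hP : P ∈ mvVariety A)
    (hi : P i ∈ infLine (Cs i)) (hj : P j ∈ infLine (Cs j)) (hk : P k ∈ infLine (Cs k))
    (hl : P l ∈ infLine (Cs l)) : False := by
  obtain ⟨y, hy⟩ := G.mem_mvVariety.mp hP
  exact hy.1 (G.four_planes i j k l hij hik hil hjk hjl hkl y (G.planeForm_eq_zero hy hi)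
    (G.planeForm_eq_zero hy hj) (G.planeForm_eq_zero hy hk) (G.planeForm_eq_zero hy hl))

theorem isoCurve_inter_infCurve (G : GoodConfig A Cs) {i j : Fin n} (hij : i ≠ j) (s : Bool) :
    ∃ P, isoCurve A Cs i s ∩ infCurve A Cs i j = {P} := by
  obtain ⟨y, hy, hφy⟩ := exists_ne_zero_map_eq_zero (by simp)
    ((isoForm (A i) (Cs i) s).prod (planeForm (A j) (Cs j)))
  have hyi : y ∈ isoLine (A i) (Cs i) s :=
    (isoForm_eq_zero_iff (G.det i)).mp (congrArg Prod.fst hφy)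
  have hyj : planeForm (A j) (Cs j) y = 0 := congrArg Prod.snd hφy
  have hne := G.mulVec_ne_zero_of_planeForm hij hy (planeForm_eq_zero_of_mem_isoLine hyi) hyj
  refine ⟨fun k => mkP ((A k).mulVec y), Set.eq_singleton_iff_unique_mem.mpr ⟨⟨?_, ?_⟩, ?_⟩⟩
  · refine G.mem_isoCurve_iff.mpr ⟨y, hy, hyi, fun _ _ => rfl, ?_⟩
    obtain ⟨t, ht⟩ := hyi
    have h0 : t ≠ 0 := by rintro rfl; exact hne i (by rw [ht, zero_smul])
    simp only [ht]
    exact mkP_smul h0 (G.mulVec_iso_ne_zero i s)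
  · exact (G.mem_infCurve_iff hij).mpr
      ⟨y, hy, planeForm_eq_zero_of_mem_isoLine hyi, hyj, hne, fun _ => rfl⟩
  · rintro P ⟨hP1, hP2⟩
    obtain ⟨y', hy', hi', hj', hne', hP⟩ := (G.mem_infCurve_iff hij).mp hP2
    have hw : IsWitness A y' P := ⟨hy', fun k => ⟨_, hne' k, hP k, 1, (one_smul _ _).symm⟩⟩
    obtain ⟨t', ht'⟩ := hw.exists_eq_smul (G.mulVec_iso_ne_zero i s) hP1.2
    obtain ⟨t, ht⟩ := hyi
    have h0 : t ≠ 0 := by rintro rfl; exact hne i (by rw [ht, zero_smul])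
    have h0' : t' ≠ 0 := by rintro rfl; exact hne' i (by rw [ht', zero_smul])
    have : y' - (t' / t) • y = 0 := by
      refine G.plane_center j i hij.symm _ (by simp [hyj, hj']) ?_
      rw [Matrix.mulVec_sub, Matrix.mulVec_smul, ht, ht', smul_smul, div_mul_cancel₀ _ h0, sub_self]
    rw [sub_eq_zero] at this
    funext k
    rw [hP k, this, Matrix.mulVec_smul, mkP_smul (div_ne_zero h0' h0) (hne k)]

theorem infCurve_inter_infLine (G : GoodConfig A Cs)
    {i j k : Fin n} (hij : i ≠ j) (hik : i ≠ k) (hjk : j ≠ k) :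
    ∃ P, {P | P k ∈ infLine (Cs k)} ∩ infCurve A Cs i j = {P} := by
  obtain ⟨y, hy, hφy⟩ := exists_ne_zero_map_eq_zero (by simp)
    ((planeForm (A k) (Cs k)).prod ((planeForm (A i) (Cs i)).prod (planeForm (A j) (Cs j))))
  have hyk : planeForm (A k) (Cs k) y = 0 := congrArg Prod.fst hφy
  have hyi : planeForm (A i) (Cs i) y = 0 := congrArg (fun p => p.2.1) hφy
  have hyj : planeForm (A j) (Cs j) y = 0 := congrArg (fun p => p.2.2) hφy
  have hne := G.mulVec_ne_zero_of_planeForm hij hy hyi hyj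
  refine ⟨fun k => mkP ((A k).mulVec y), Set.eq_singleton_iff_unique_mem.mpr ⟨⟨?_, ?_⟩, ?_⟩⟩
  · exact (mkP_mem_infLine_iff_planeForm (G.det k) (hne k)).mpr hyk
  · exact (G.mem_infCurve_iff hij).mpr ⟨y, hy, hyi, hyj, hne, fun _ => rfl⟩
  · rintro P ⟨hP1, hP2⟩
    obtain ⟨y', hy', hi', hj', hne', hP⟩ := (G.mem_infCurve_iff hij).mp hP2
    have hw : IsWitness A y' P := ⟨hy', fun k => ⟨_, hne' k, hP k, 1, (one_smul _ _).symm⟩⟩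
    obtain ⟨c, rfl⟩ := G.three_planes i j k hij hik hjk y y' hy hyi hyj hyk hi' hj'
      (G.planeForm_eq_zero hw hP1)
    have hc : c ≠ 0 := by rintro rfl; simp at hy'
    funext m
    rw [hP m, Matrix.mulVec_smul, mkP_smul hc (hne m)]

/-- A line at infinity meets the union of all curves `isoCurve` and those curves `infCurve`
which precede it in exactly `j + 3` points. -/
theorem inter_infCurve (G : GoodConfig A Cs) {i j : Fin n} (hij : i < j) {X : Set (Fin n → P2)}
    (hX : X = (⋃ p : Fin n × Bool, isoCurve A Cs p.1 p.2) ∪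
      {P | ∃ k l, k < l ∧ (l < j ∨ l = j ∧ k < i) ∧ P ∈ infCurve A Cs k l}) :
    (X ∩ infCurve A Cs i j).Finite ∧ (X ∩ infCurve A Cs i j).ncard = j.1 + 3 := by
  classical
  choose a ha using G.isoCurve_inter_infCurve hij.ne
  choose b hb using G.isoCurve_inter_infCurve hij.ne'
  have ht : ∀ k : Fin n, ∃ P, k < j → k ≠ i →
      {P | P k ∈ infLine (Cs k)} ∩ infCurve A Cs i j = {P} := fun k => by
    by_cases h : k < j ∧ k ≠ i
    · obtain ⟨P, hP⟩ := G.infCurve_inter_infLine hij.ne h.2.symm h.1.ne'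
      exact ⟨P, fun _ _ => hP⟩
    · exact ⟨fun _ => mkP 0, fun h1 h2 => absurd ⟨h1, h2⟩ h⟩
  choose t ht using ht
  rw [infCurve_comm j i] at hb
  have ha' : ∀ s, a s ∈ isoCurve A Cs i s ∩ infCurve A Cs i j := fun s => by rw [ha]; rfl
  have hb' : ∀ s, b s ∈ isoCurve A Cs j s ∩ infCurve A Cs i j := fun s => by rw [hb]; rfl
  have ht' : ∀ k ∈ (Finset.Iio j).erase i,
      t k ∈ {P | P k ∈ infLine (Cs k)} ∩ infCurve A Cs i j := fun k hk => by
    rw [Finset.mem_erase, Finset.mem_Iio] at hk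
    rw [ht k hk.2 hk.1]; rfl
  let F : Finset (Fin n → P2) := (Finset.univ.image a ∪ Finset.univ.image b) ∪
    ((Finset.Iio j).erase i).image t
  have hF : X ∩ infCurve A Cs i j = ↑F := by
    apply Set.Subset.antisymm
    · rintro P ⟨hPX, hP⟩
      rw [hX] at hPX
      have key : ∀ k, k < j → k ≠ i → P k ∈ infLine (Cs k) → P ∈ (F : Set (Fin n → P2)) := by
        intro k h1 h2 h3
        have : P = t k := by
          have h4 : P ∈ {P | P k ∈ infLine (Cs k)} ∩ infCurve A Cs i j := ⟨h3, hP⟩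
          rw [ht k h1 h2] at h4; exact h4
        rw [this]
        simp only [F, Finset.coe_union, Finset.coe_image]
        exact Or.inr ⟨k, by simp [h1, h2], rfl⟩
      rcases hPX with hPX | ⟨k, l, hkl, hlt, hPkl⟩
      · obtain ⟨⟨k, s⟩, hk⟩ := Set.mem_iUnion.mp hPX
        by_cases hki : k = i
        · subst hki
          have : P = a s := by
            have h4 : P ∈ isoCurve A Cs k s ∩ infCurve A Cs k j := ⟨hk, hP⟩
            rw [ha] at h4; exact h4
          rw [this]
          exact Finset.mem_union_left _ (Finset.mem_union_left _
            (Finset.mem_image_of_mem a (Finset.mem_univ s)))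
        · by_cases hkj : k = j
          · subst hkj
            have : P = b s := by
              have h4 : P ∈ isoCurve A Cs k s ∩ infCurve A Cs i k := ⟨hk, hP⟩
              rw [hb] at h4; exact h4
            rw [this]
            exact Finset.mem_union_left _ (Finset.mem_union_right _
              (Finset.mem_image_of_mem b (Finset.mem_univ s)))
          · exact (G.isoCurve_inter_infLine hki hkj hij.ne hk hP.2.1 hP.2.2).elim
      · rcases hlt with hlj | ⟨rfl, hki⟩
        · by_cases hli : l = i
          · exact key k (hkl.trans hlj) (hli ▸ hkl.ne) hPkl.2.1
          · exact key l hlj hli hPkl.2.2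
        · exact key k hkl hki.ne hPkl.2.1
    · intro P hP
      simp only [F, Finset.coe_union, Finset.coe_image, Finset.coe_univ, Set.image_univ] at hP
      rw [hX]
      rcases hP with (⟨s, rfl⟩ | ⟨s, rfl⟩) | ⟨k, hk, rfl⟩
      · exact ⟨Or.inl (Set.mem_iUnion.mpr ⟨(i, s), (ha' s).1⟩), (ha' s).2⟩
      · exact ⟨Or.inl (Set.mem_iUnion.mpr ⟨(j, s), (hb' s).1⟩), (hb' s).2⟩
      · have h := ht' k hk
        rw [Finset.mem_coe, Finset.mem_erase, Finset.mem_Iio] at hk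
        refine ⟨Or.inr ?_, h.2⟩
        rcases lt_or_gt_of_ne hk.1 with hlt | hlt
        · exact ⟨k, j, hk.2, Or.inr ⟨rfl, hlt⟩, h.2.1, h.1, h.2.2.2⟩
        · exact ⟨i, k, hlt, Or.inl hk.2, h.2.1, h.2.2.1, h.1⟩
  rw [hF]
  refine ⟨F.finite_toSet, ?_⟩
  rw [Set.ncard_coe_finset]
  rw [Finset.card_union_of_disjoint, Finset.card_union_of_disjoint, Finset.card_image_of_injOn,
    Finset.card_image_of_injOn, Finset.card_image_of_injOn, Finset.card_erase_of_mem
    (Finset.mem_Iio.mpr hij), Fin.card_Iio, Finset.card_univ, Fintype.card_bool]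
  · have : i.1 < j.1 := hij
    omega
  · intro k hk l hl hkl
    by_contra hne
    have h1 := ht' k hk
    have h2 := ht' l hl
    have hkl' : t k = t l := hkl
    rw [← hkl'] at h2
    rw [Finset.mem_coe, Finset.mem_erase, Finset.mem_Iio] at hk hl
    exact G.not_four_infLine hij.ne (Ne.symm hk.1) (Ne.symm hl.1) hk.2.ne' hl.2.ne' hne h1.2.1
      h1.2.2.1 h1.2.2.2 h1.1 h2.1
  · intro s _ s' _ h
    by_contra hne
    have h' : b s = b s' := h
    exact G.isoCurve_inter_isoCurve (by simpa using hne) (hb' s).1 (h' ▸ (hb' s').1)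
  · intro s _ s' _ h
    by_contra hne
    have h' : a s = a s' := h
    exact G.isoCurve_inter_isoCurve (by simpa using hne) (ha' s).1 (h' ▸ (ha' s').1)
  · rw [Finset.disjoint_left]
    intro P h1 h2
    obtain ⟨s, -, rfl⟩ := Finset.mem_image.mp h1
    obtain ⟨s', -, h⟩ := Finset.mem_image.mp h2
    exact G.isoCurve_inter_isoCurve (by simp [hij.ne]) (ha' s).1 (h ▸ (hb' s').1)
  · rw [Finset.disjoint_left]
    intro P h1 h2
    obtain ⟨k, hk, h⟩ := Finset.mem_image.mp h2
    have hk' := ht' k hk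
    rw [h] at hk'
    rw [Finset.mem_erase, Finset.mem_Iio] at hk
    rcases Finset.mem_union.mp h1 with h1 | h1
    · obtain ⟨s, -, rfl⟩ := Finset.mem_image.mp h1
      exact G.isoCurve_inter_infLine hij.ne hk.1.symm hk.2.ne' (ha' s).1 (ha' s).2.2.2 hk'.1
    · obtain ⟨s, -, rfl⟩ := Finset.mem_image.mp h1
      exact G.isoCurve_inter_infLine hij.ne' hk.2.ne' hk.1.symm (hb' s).1 (hb' s).2.2.1 hk'.1

theorem cellSet_isoCurves (G : GoodConfig A Cs) (hn : 2 ≤ n) (F : Finset (Fin n × Bool)) :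
    CellSet (⋃ p ∈ F, isoCurve A Cs p.1 p.2) (2 * F.card) := by
  classical
  induction F using Finset.induction_on with
  | empty => simpa using CellSet.empty
  | insert p F hp ih =>
    have hdisj : (⋃ p ∈ F, isoCurve A Cs p.1 p.2) ∩ isoCurve A Cs p.1 p.2 = ∅ := by
      rw [Set.eq_empty_iff_forall_notMem]
      rintro P ⟨h1, h2⟩
      simp only [Set.mem_iUnion] at h1
      obtain ⟨q, hq, h1⟩ := h1
      exact G.isoCurve_inter_isoCurve (i := q.1) (s := q.2) (j := p.1) (t := p.2)
        (fun h => hp (by rw [← (show q = p from h)]; exact hq)) h1 h2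
    have := ih.union_sphere (G.isSphere_isoCurve hn p.1 p.2) (by rw [hdisj]; exact Set.finite_empty)
    rw [hdisj, Set.ncard_empty] at this
    rw [Finset.set_biUnion_insert, Set.union_comm, Finset.card_insert_of_notMem hp]
    convert this using 1
    push_cast
    ring

theorem cellSet_stage (G : GoodConfig A Cs)
    (hn : 2 ≤ n) (m l : ℕ) (hl : l ≤ m) (hm : m < n ∨ m = n ∧ l = 0) :
    ∃ c : ℤ, CellSet ((⋃ p : Fin n × Bool, isoCurve A Cs p.1 p.2) ∪
      {P | ∃ i j : Fin n, i < j ∧ (j.1 < m ∨ j.1 = m ∧ i.1 < l) ∧ P ∈ infCurve A Cs i j}) c ∧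
      3 * c = 12 * n - (m - 1) * m * (m + 1) - 3 * l * (m + 1) := by
  induction m generalizing l with
  | zero =>
    obtain rfl : l = 0 := by omega
    refine ⟨4 * n, ?_, by push_cast; ring⟩
    have := G.cellSet_isoCurves hn Finset.univ
    convert this using 1
    · simp
    · simp; ring
  | succ m ihm =>
    induction l with
    | zero =>
      obtain ⟨c, hc, hc3⟩ := ihm m le_rfl (by omega)
      refine ⟨c, ?_, by rw [hc3]; push_cast; ring⟩
      convert hc using 3
      ext P
      refine exists_congr fun i => exists_congr fun j => and_congr_right fun hij => ?_
      have : i.1 < j.1 := hij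
      refine and_congr_left fun _ => ?_
      omega
    | succ l ihl =>
      have hm : m + 1 < n := by omega
      obtain ⟨c, hc, hc3⟩ := ihl (by omega) (by omega)
      let i : Fin n := ⟨l, by omega⟩
      let j : Fin n := ⟨m + 1, hm⟩
      have hij : i < j := Fin.mk_lt_mk.mpr (by omega)
      obtain ⟨hfin, hcard⟩ := G.inter_infCurve hij (X := (⋃ p : Fin n × Bool,
        isoCurve A Cs p.1 p.2) ∪ {P | ∃ i j : Fin n, i < j ∧
          (j.1 < m + 1 ∨ j.1 = m + 1 ∧ i.1 < l) ∧ P ∈ infCurve A Cs i j}) (by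
        simp only [Fin.lt_def, Fin.ext_iff, i, j])
      have h := hc.union_sphere (G.isSphere_infCurve hij.ne) hfin
      refine ⟨c + 2 - (m + 4 : ℕ), ?_, ?_⟩
      · convert h using 1
        · rw [Set.union_assoc]
          congr 1
          ext P
          constructor
          · rintro ⟨i', j', h1, h2, h3⟩
            by_cases h : i' = i ∧ j' = j
            · rw [h.1, h.2] at h3; exact Or.inr h3
            · refine Or.inl ⟨i', j', h1, ?_, h3⟩
              simp only [Fin.ext_iff, i, j] at h
              omega
          · rintro (⟨i', j', h1, h2, h3⟩ | h3)
            · exact ⟨i', j', h1, by omega, h3⟩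
            · exact ⟨i, j, hij, Or.inr ⟨rfl, Nat.lt_succ_self l⟩, h3⟩
        · rw [hcard]
      · push_cast at hc3 ⊢
        linear_combination hc3

theorem hasEulerChar (G : GoodConfig A Cs) (hn : 2 ≤ n) (β : Fin (2 * n + 1) → ℂ) :
    ∃ e : ℤ, HasEulerChar ↥(DQ A Cs β ∩ DinfAll A Cs) e ∧ 3 * e = -(n : ℤ) ^ 3 + 13 * (n : ℤ) := by
  obtain ⟨c, hc, hc3⟩ := G.cellSet_stage hn n 0 (Nat.zero_le _) (Or.inr ⟨rfl, rfl⟩)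
  refine ⟨c, ?_, by rw [hc3]; push_cast; ring⟩
  rw [DQ_inter_DinfAll_eq G.det]
  have := hc.hasEulerChar
  have hset : {P | ∃ i j, i < j ∧ P ∈ infCurve A Cs i j} = {P | ∃ i j : Fin n, i < j ∧
      (j.1 < n ∨ j.1 = n ∧ i.1 < 0) ∧ P ∈ infCurve A Cs i j} := by
    simp
  rw [hset]
  exact this

end GoodConfig

end

noncomputable section

open scoped Manifold Topology
open Filter

/-! ### Genericity -/

section Generically

variable {σ : Type}

theorem Generically.mono {P Q : (σ → ℂ) → Prop} (hP : Generically P) (h : ∀ x, P x → Q x) :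
    Generically Q := by
  obtain ⟨q, hq, hP⟩ := hP
  exact ⟨q, hq, fun x hx => h x (hP x hx)⟩

theorem generically_of_forall {P : (σ → ℂ) → Prop} (h : ∀ x, P x) : Generically P :=
  ⟨1, one_ne_zero, fun x _ => h x⟩

theorem Generically.and {P Q : (σ → ℂ) → Prop} (hP : Generically P) (hQ : Generically Q) :
    Generically fun x => P x ∧ Q x := by
  obtain ⟨p, hp, hP⟩ := hP
  obtain ⟨q, hq, hQ⟩ := hQ
  refine ⟨p * q, mul_ne_zero hp hq, fun x hx => ?_⟩
  rw [map_mul] at hx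
  exact ⟨hP x (left_ne_zero_of_mul hx), hQ x (right_ne_zero_of_mul hx)⟩

theorem generically_forall {ι : Type} [Fintype ι] {P : ι → (σ → ℂ) → Prop}
    (h : ∀ i, Generically (P i)) : Generically fun x => ∀ i, P i x := by
  choose q hq hP using h
  refine ⟨∏ i, q i, Finset.prod_ne_zero_iff.mpr fun i _ => hq i, fun x hx i => ?_⟩
  rw [map_prod, Finset.prod_ne_zero_iff] at hx
  exact hP i x (hx i (Finset.mem_univ i))

theorem generically_imp {p : Prop} {P : (σ → ℂ) → Prop} (h : p → Generically P) :
    Generically fun x => p → P x := by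
  by_cases hp : p
  · exact (h hp).mono fun _ hx _ => hx
  · exact generically_of_forall fun _ h => absurd h hp

/-- Polynomial functions. -/
def polyFun (σ : Type) : Subalgebra ℂ ((σ → ℂ) → ℂ) :=
  (MvPolynomial.aeval fun (i : σ) (x : σ → ℂ) => x i).range

theorem coord_mem_polyFun (i : σ) : (fun x => x i) ∈ polyFun σ :=
  ⟨MvPolynomial.X i, by simp⟩

theorem const_mem_polyFun (c : ℂ) : (fun _ => c) ∈ polyFun σ :=
  (polyFun σ).algebraMap_mem c

theorem generically_ne_zero {f : (σ → ℂ) → ℂ} (hf : f ∈ polyFun σ) {x₀ : σ → ℂ} (h₀ : f x₀ ≠ 0) :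
    Generically fun x => f x ≠ 0 := by
  obtain ⟨q, rfl⟩ := hf
  have hq : ∀ x, (MvPolynomial.aeval (fun (i : σ) (x : σ → ℂ) => x i) q) x =
      MvPolynomial.eval x q := fun x => by
    clear h₀
    induction q using MvPolynomial.induction_on with
    | C a => simp
    | add p q hp hq => simp [hp, hq]
    | mul_X p i hp => simp [hp]
  refine ⟨q, ?_, fun x hx => ?_⟩
  · rintro rfl
    simp at h₀
  · exact fun h => hx ((hq x).symm.trans h)

/-- Linear forms depending polynomially on parameters. -/
def PolyFam (f : (σ → ℂ) → (Fin 4 → ℂ) →ₗ[ℂ] ℂ) : Prop :=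
  ∀ y, (fun x => f x y) ∈ polyFun σ

theorem polyFam_const (f : (Fin 4 → ℂ) →ₗ[ℂ] ℂ) : PolyFam fun _ : σ → ℂ => f :=
  fun _ => const_mem_polyFun _

theorem det_mem_polyFun {m : ℕ} {M : (σ → ℂ) → Matrix (Fin m) (Fin m) ℂ}
    (hM : ∀ a b, (fun x => M x a b) ∈ polyFun σ) : (fun x => (M x).det) ∈ polyFun σ := by
  have : (fun x => (M x).det) = ∑ e : Equiv.Perm (Fin m),
      Equiv.Perm.sign e • ∏ k, fun x => M x (e k) k := by
    funext x
    simp [Matrix.det_apply, Finset.sum_apply, Finset.prod_apply]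
  rw [this]
  refine sum_mem fun e _ => ?_
  rw [Units.smul_def]
  exact zsmul_mem (prod_mem fun k _ => hM _ _) _

theorem generically_ker_eq_bot {f₁ f₂ f₃ f₄ : (σ → ℂ) → (Fin 4 → ℂ) →ₗ[ℂ] ℂ} (h₁ : PolyFam f₁)
    (h₂ : PolyFam f₂) (h₃ : PolyFam f₃) (h₄ : PolyFam f₄) (x₀ : σ → ℂ)
    (h₀ : ∀ y, f₁ x₀ y = 0 → f₂ x₀ y = 0 → f₃ x₀ y = 0 → f₄ x₀ y = 0 → y = 0) :
    Generically fun x => ∀ y, f₁ x y = 0 → f₂ x y = 0 → f₃ x y = 0 → f₄ x y = 0 → y = 0 := by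
  let F : (σ → ℂ) → (Fin 4 → ℂ) →ₗ[ℂ] (Fin 4 → ℂ) := fun x =>
    LinearMap.pi ![f₁ x, f₂ x, f₃ x, f₄ x]
  have hF : ∀ x, (∀ y, f₁ x y = 0 → f₂ x y = 0 → f₃ x y = 0 → f₄ x y = 0 → y = 0) ↔
      (LinearMap.toMatrix' (F x)).det ≠ 0 := by
    intro x
    rw [ne_eq, ← Matrix.exists_mulVec_eq_zero_iff]
    simp only [LinearMap.toMatrix'_mulVec, not_exists, not_and, funext_iff, F, LinearMap.pi_apply,
      Fin.forall_fin_succ, ne_eq]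
    simp
    refine forall_congr' fun y => ?_
    tauto
  have hM : (fun x => (LinearMap.toMatrix' (F x)).det) ∈ polyFun σ := by
    refine det_mem_polyFun fun a b => ?_
    simp only [LinearMap.toMatrix'_apply, F, LinearMap.pi_apply]
    fin_cases a
    · exact h₁ _
    · exact h₂ _
    · exact h₃ _
    · exact h₄ _
  exact (generically_ne_zero hM ((hF x₀).mp h₀)).mono fun x hx => (hF x).mpr hx

end Generically

theorem generically_centers (n : ℕ) : Generically (K := ℂ) (σ := Fin n × Fin 3 × Fin 4) fun a =>
    ∀ i j, i ≠ j → ∀ y, (camOfC a i).mulVec y = 0 → (camOfC a j).mulVec y = 0 → y = 0 := by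
  refine generically_forall fun i => generically_forall fun j => generically_imp fun hij => ?_
  have hpoly : ∀ (k : Fin n) (r : Fin 3),
      PolyFam fun a => LinearMap.proj r ∘ₗ (camOfC a k).mulVecLin := by
    intro k r y
    have : (fun a => (LinearMap.proj r ∘ₗ (camOfC a k).mulVecLin) y) =
        ∑ c, (fun a => a (k, r, c)) * fun _ => y c := by
      funext a
      simp [camOfC, Matrix.mulVec, dotProduct, Finset.sum_apply]
    rw [this]
    exact sum_mem fun c _ => mul_mem (coord_mem_polyFun _) (const_mem_polyFun _)
  refine (generically_ker_eq_bot (hpoly i 0) (hpoly i 1) (hpoly i 2) (hpoly j 0)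
    (fun p => if p.1 = i then (if p.2.2 = p.2.1.castSucc then 1 else 0) else
      if p.2.2 = 3 then 1 else 0) ?_).mono ?_
  · intro y h1 h2 h3 h4
    simp [camOfC, Matrix.mulVec, dotProduct, hij.symm] at h1 h2 h3 h4
    funext k
    fin_cases k
    · exact h1
    · exact h2
    · exact h3
    · exact h4
  · intro a h y hi hj
    exact h y (congrFun hi 0) (congrFun hi 1) (congrFun hi 2) (congrFun hj 0)

section Charts

variable {n : ℕ} {A : Fin n → Matrix (Fin 3) (Fin 4) ℂ}

theorem polyFam_adjugate (i : Fin n) (r : Fin 3) : PolyFam fun c : Fin n × Fin 3 × Fin 3 → ℂ =>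
    LinearMap.proj r ∘ₗ ((chartOf c i).adjugate * A i).mulVecLin := by
  intro y
  have : (fun c : Fin n × Fin 3 × Fin 3 → ℂ =>
      (LinearMap.proj r ∘ₗ ((chartOf c i).adjugate * A i).mulVecLin) y) =
      ∑ k, (fun c => (chartOf c i).adjugate r k) * fun _ => (A i).mulVec y k := by
    funext c
    simp [Matrix.mulVec, dotProduct, Finset.sum_apply]
  rw [this]
  refine sum_mem fun k _ => mul_mem ?_ (const_mem_polyFun _)
  simp only [Matrix.adjugate_apply]
  refine det_mem_polyFun fun a b => ?_
  simp only [Matrix.updateRow_apply]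
  split_ifs
  · exact const_mem_polyFun _
  · exact coord_mem_polyFun _

theorem polyFam_planeForm (i : Fin n) :
    PolyFam fun c : Fin n × Fin 3 × Fin 3 → ℂ => planeForm (A i) (chartOf c i) :=
  polyFam_adjugate i 0

theorem polyFam_isoForm (i : Fin n) (s : Bool) : PolyFam fun c : Fin n × Fin 3 × Fin 3 → ℂ =>
    LinearMap.snd ℂ ℂ ℂ ∘ₗ isoForm (A i) (chartOf c i) s := fun y =>
  sub_mem (polyFam_adjugate i 2 y)
    (mul_mem (const_mem_polyFun (sgn s)) (polyFam_adjugate i 1 y))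

theorem exists_chart_planeForm {Am : Matrix (Fin 3) (Fin 4) ℂ} (hA : Function.Surjective Am.mulVec)
    {h : (Fin 4 → ℂ) →ₗ[ℂ] ℂ} (h0 : h ≠ 0) (hker : ∀ y, Am.mulVec y = 0 → h y = 0) :
    ∃ Cm : Matrix (Fin 3) (Fin 3) ℂ, ∀ y, planeForm Am Cm y = 0 ↔ h y = 0 := by
  obtain ⟨B, hB⟩ := Am.mulVecLin.exists_rightInverse_of_surjective (LinearMap.range_eq_top.mpr hA)
  have hh : ∀ y, h y = h (B (Am.mulVec y)) := fun y => by
    rw [← sub_eq_zero, ← map_sub]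
    refine hker _ ?_
    have := LinearMap.congr_fun hB (Am.mulVec y)
    simp only [LinearMap.comp_apply, Matrix.mulVecLin_apply, LinearMap.id_apply] at this
    rw [Matrix.mulVec_sub, this, sub_self]
  obtain ⟨l, hl⟩ : ∃ l : Fin 3 → ℂ, ∀ x, h (B x) = ∑ k, x k * l k :=
    ⟨fun k => h (B (Pi.single k 1)), fun x => by
      conv_lhs => rw [← Finset.univ_sum_single x]
      simp only [map_sum]
      refine Finset.sum_congr rfl fun k _ => ?_
      rw [← mul_one (x k), ← smul_eq_mul (x k) 1, Pi.single_smul, map_smul, map_smul]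
      simp⟩
  have hl0 : l ≠ 0 := by
    rintro rfl
    exact h0 (LinearMap.ext fun y => by rw [hh, hl]; simp)
  obtain ⟨Cm, t, ht, hC⟩ : ∃ (Cm : Matrix (Fin 3) (Fin 3) ℂ) (t : ℂ), t ≠ 0 ∧
      ∀ k, Cm.adjugate 0 k = t * l k := by
    obtain ⟨k, hk⟩ := Function.ne_iff.mp hl0
    fin_cases k
    · refine ⟨!![0, -l 1, -l 2; 0, l 0, 0; 0, 0, l 0], l 0, hk, fun k => ?_⟩
      fin_cases k <;> simp [Matrix.adjugate_fin_three] <;> ring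
    · refine ⟨!![0, 0, l 1; 0, -l 2, -l 0; 0, l 1, 0], l 1, hk, fun k => ?_⟩
      fin_cases k <;> simp [Matrix.adjugate_fin_three]
      ring
    · refine ⟨!![0, l 2, 0; 0, 0, l 2; 0, -l 0, -l 1], l 2, hk, fun k => ?_⟩
      fin_cases k <;> simp [Matrix.adjugate_fin_three]
  refine ⟨Cm, fun y => ?_⟩
  have : planeForm Am Cm y = t * h y := by
    rw [planeForm_apply, hh, hl, Matrix.mulVec, dotProduct, Finset.mul_sum]
    refine Finset.sum_congr rfl fun k _ => ?_
    rw [hC]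
    ring
  rw [this]
  simp [ht]

theorem exists_chart_isoVec {r : Fin 3 → ℂ} (hr : r ≠ 0) (s : Bool) :
    ∃ Cm : Matrix (Fin 3) (Fin 3) ℂ, IsUnit Cm.det ∧ Cm.mulVec (isoVec s) = r := by
  simp only [isUnit_iff_ne_zero]
  obtain ⟨k, hk⟩ := Function.ne_iff.mp hr
  fin_cases k
  · refine ⟨!![0, r 0, 0; 0, r 1 - sgn s, 1; 1, r 2, 0], ?_, ?_⟩
    · simpa [Matrix.det_fin_three] using hk
    · funext k
      fin_cases k <;> simp [isoVec, Matrix.mulVec, dotProduct, Fin.sum_univ_three]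
  · refine ⟨!![0, r 0 - sgn s, 1; 0, r 1, 0; 1, r 2, 0], ?_, ?_⟩
    · simpa [Matrix.det_fin_three] using hk
    · funext k
      fin_cases k <;> simp [isoVec, Matrix.mulVec, dotProduct, Fin.sum_univ_three]
  · refine ⟨!![0, r 0 - sgn s, 1; 1, r 1, 0; 0, r 2, 0], ?_, ?_⟩
    · simpa [Matrix.det_fin_three] using hk
    · funext k
      fin_cases k <;> simp [isoVec, Matrix.mulVec, dotProduct, Fin.sum_univ_three]

end Charts

end

noncomputable section

open scoped Manifold Topology
open Filter

section LinearAlgebra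

theorem exists_dual_ne_zero {S : Submodule ℂ (Fin 4 → ℂ)} {v : Fin 4 → ℂ} (hv : v ∉ S) :
    ∃ h : (Fin 4 → ℂ) →ₗ[ℂ] ℂ, h v ≠ 0 ∧ ∀ w ∈ S, h w = 0 := by
  obtain ⟨h, h1, h2⟩ := S.exists_le_ker_of_notMem hv
  exact ⟨h, h1, fun w hw => h2 hw⟩

theorem exists_dual_of_ne_smul {c v : Fin 4 → ℂ} (hv : ∀ t : ℂ, v ≠ t • c) :
    ∃ h : (Fin 4 → ℂ) →ₗ[ℂ] ℂ, h v ≠ 0 ∧ h c = 0 := by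
  obtain ⟨h, h1, h2⟩ := exists_dual_ne_zero (S := Submodule.span ℂ {c}) (v := v) fun hmem => by
    obtain ⟨t, ht⟩ := Submodule.mem_span_singleton.mp hmem
    exact hv t ht.symm
  exact ⟨h, h1, h2 c (Submodule.mem_span_singleton_self c)⟩

theorem exists_notMem_span {F : Finset (Fin 4 → ℂ)} (hF : F.card < 4) :
    ∃ v, v ∉ Submodule.span ℂ (F : Set (Fin 4 → ℂ)) := by
  by_contra! h
  have h1 : Submodule.span ℂ (F : Set (Fin 4 → ℂ)) = ⊤ := eq_top_iff.mpr fun x _ => h x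
  have h2 := finrank_span_finset_le_card (R := ℂ) F
  rw [Set.finrank, h1, finrank_top] at h2
  simp at h2
  omega

theorem exists_three_forms {ci cj ck d : Fin 4 → ℂ} (hid : ∀ t : ℂ, d ≠ t • ci)
    (hij : ∀ t : ℂ, ci ≠ t • cj) :
    ∃ hi hj hk : (Fin 4 → ℂ) →ₗ[ℂ] ℂ, hi ci = 0 ∧ hj cj = 0 ∧ hk ck = 0 ∧ hi ≠ 0 ∧ hj ≠ 0 ∧
      hk ≠ 0 ∧ ∃ z, (∀ t : ℂ, z ≠ t • d) ∧
        ∀ w, hi w = 0 → hj w = 0 → hk w = 0 → ∃ s : ℂ, w = s • z := by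
  obtain ⟨hi, hid', hii⟩ := exists_dual_of_ne_smul hid
  obtain ⟨hj, hji, hjj⟩ := exists_dual_of_ne_smul hij
  have hφ : Function.Surjective (hi.prod hj) := by
    rintro ⟨a, b⟩
    refine ⟨(a / hi d) • d + ((b - a / hi d * hj d) / hj ci) • ci, ?_⟩
    refine Prod.ext ?_ ?_
    · simp [hii, hid']
    · simp [hji]
  obtain ⟨y, hy, hφy⟩ := exists_ne_zero_map_eq_zero (by simp) (hi.prod hj)
  obtain ⟨x, hφx, hind, hspan⟩ := exists_ne_zero_of_surjective_prod hφ hy hφy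
  obtain ⟨u, v, hφu, hφv, hind, hspan, hv⟩ : ∃ u v, (hi.prod hj) u = 0 ∧ (hi.prod hj) v = 0 ∧
      (∀ s t : ℂ, s • u + t • v = 0 → s = 0 ∧ t = 0) ∧
      (∀ w, (hi.prod hj) w = 0 → ∃ s t : ℂ, w = s • u + t • v) ∧ ∀ t : ℂ, v ≠ t • ck := by
    by_cases h : ∀ t : ℂ, y ≠ t • ck
    · exact ⟨x, y, hφx, hφy, hind, hspan, h⟩
    · push Not at h
      obtain ⟨t, rfl⟩ := h
      refine ⟨t • ck, x, hφy, hφx, fun a b hab => ?_, fun w hw => ?_, ?_⟩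
      · exact (hind b a (by rw [add_comm]; exact hab)).symm
      · obtain ⟨a, b, hab⟩ := hspan w hw
        exact ⟨b, a, by rw [add_comm]; exact hab⟩
      · rintro t' rfl
        have := hind t (-t') (by module)
        simp [this.1] at hy
  obtain ⟨hk, hkv, hkk⟩ := exists_dual_of_ne_smul hv
  refine ⟨hi, hj, hk, hii, hjj, hkk, ?_, ?_, ?_, u - (hk u / hk v) • v, ?_, ?_⟩
  · rintro rfl; simp at hid'
  · rintro rfl; simp at hji
  · rintro rfl; simp at hkv
  · intro t ht
    have h1 : hi u = 0 := congrArg Prod.fst hφu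
    have h2 : hi v = 0 := congrArg Prod.fst hφv
    have h3 := congrArg hi ht
    simp only [map_sub, map_smul, h1, h2, mul_zero, sub_zero, smul_eq_mul] at h3
    have h4 : t = 0 := by
      rcases mul_eq_zero.mp h3.symm with h | h
      · exact h
      · exact absurd h hid'
    have := hind 1 (-(hk u / hk v)) (by rw [h4, zero_smul] at ht; rw [← ht]; module)
    exact one_ne_zero this.1
  · intro w h1 h2 h3
    obtain ⟨s, t, rfl⟩ := hspan w (Prod.ext h1 h2)
    refine ⟨s, ?_⟩
    simp only [map_add, map_smul, smul_eq_mul] at h3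
    have : t = -(s * (hk u / hk v)) := by
      field_simp
      linear_combination h3
    rw [this]
    module

end LinearAlgebra

section Witnesses

variable {n : ℕ} {A : Fin n → Matrix (Fin 3) (Fin 4) ℂ}

theorem exists_center {Am : Matrix (Fin 3) (Fin 4) ℂ} (hA : Function.Surjective Am.mulVec) :
    ∃ c, c ≠ 0 ∧ Am.mulVec c = 0 ∧ ∀ y, Am.mulVec y = 0 → ∃ t : ℂ, y = t • c := by
  have h1 : Module.finrank ℂ (LinearMap.ker Am.mulVecLin) = 1 := by
    have := LinearMap.finrank_range_add_finrank_ker Am.mulVecLin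
    rw [LinearMap.range_eq_top.mpr hA, finrank_top] at this
    simp at this
    omega
  obtain ⟨c, hc, h⟩ := finrank_eq_one_iff'.mp h1
  refine ⟨c, by simpa using hc, c.2, fun y hy => ?_⟩
  obtain ⟨t, ht⟩ := h ⟨y, hy⟩
  exact ⟨t, (congrArg Subtype.val ht).symm⟩

theorem eq_of_mem_isoLine {Am : Matrix (Fin 3) (Fin 4) ℂ} {Cm : Matrix (Fin 3) (Fin 3) ℂ} {s : Bool}
    {c x : Fin 4 → ℂ} (hc : ∀ y, Am.mulVec y = 0 → ∃ t : ℂ, y = t • c)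
    (hx : Cm.mulVec (isoVec s) = Am.mulVec x) {y : Fin 4 → ℂ} (hy : y ∈ isoLine Am Cm s) :
    ∃ a b : ℂ, y = a • c + b • x := by
  obtain ⟨b, hb⟩ := hy
  obtain ⟨a, ha⟩ := hc (y - b • x) (by rw [Matrix.mulVec_sub, Matrix.mulVec_smul, hb, hx, sub_self])
  exact ⟨a, b, by rw [← ha]; module⟩

theorem generically_goodConfig (hA : ∀ i, Function.Surjective (A i).mulVec)
    (h0 : ∀ i j, i ≠ j → ∀ y, (A i).mulVec y = 0 → (A j).mulVec y = 0 → y = 0) :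
    Generically (K := ℂ) (σ := Fin n × Fin 3 × Fin 3) fun cpar =>
      (∀ i, IsUnit (chartOf cpar i).det) → GoodConfig A (chartOf cpar) := by
  have hcen := fun i => exists_center (hA i)
  choose c hc hAc hspan using hcen
  have hind : ∀ i j, i ≠ j → ∀ t : ℂ, c i ≠ t • c j := fun i j hij t ht =>
    hc i (h0 i j hij _ (hAc i) (by rw [ht, Matrix.mulVec_smul, hAc, smul_zero]))
  have hreal : ∀ i (h : (Fin 4 → ℂ) →ₗ[ℂ] ℂ), h ≠ 0 → h (c i) = 0 →
      ∃ Cm, ∀ y, planeForm (A i) Cm y = 0 ↔ h y = 0 := fun i h hh hhc =>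
    exists_chart_planeForm (hA i) hh fun y hy => by
      obtain ⟨t, rfl⟩ := hspan i y hy
      rw [map_smul, hhc, smul_zero]
  let par : (Fin n → Matrix (Fin 3) (Fin 3) ℂ) → Fin n × Fin 3 × Fin 3 → ℂ :=
    fun D p => D p.1 p.2.1 p.2.2
  have hpar : ∀ D i, chartOf (par D) i = D i := fun D i => rfl
  have g1 : Generically (K := ℂ) (σ := Fin n × Fin 3 × Fin 3) fun cpar =>
      ∀ i j, i ≠ j → ∀ y, planeForm (A i) (chartOf cpar i) y = 0 →
        (A j).mulVec y = 0 → y = 0 := by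
    refine generically_forall fun i => generically_forall fun j => generically_imp fun hij => ?_
    have hj := fun r : Fin 3 => polyFam_const (σ := Fin n × Fin 3 × Fin 3)
      (LinearMap.proj r ∘ₗ (A j).mulVecLin)
    obtain ⟨h, hhj, hhi⟩ := exists_dual_of_ne_smul (hind j i hij.symm)
    obtain ⟨C, hC⟩ := hreal i h (by rintro rfl; simp at hhj) hhi
    refine (generically_ker_eq_bot (polyFam_planeForm (A := A) i) (hj 0) (hj 1) (hj 2)
      (par fun _ => C) ?_).mono ?_
    · intro y hy h1 h2 h3
      replace hy := (hC y).mp hy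
      obtain ⟨t, rfl⟩ := hspan j y (by
        funext r
        fin_cases r
        exacts [h1, h2, h3])
      rw [map_smul, smul_eq_mul] at hy
      rw [(mul_eq_zero.mp hy).resolve_right hhj, zero_smul]
    · exact fun cpar H y hy hjy => H y hy (congrFun hjy 0) (congrFun hjy 1) (congrFun hjy 2)
  have g2 : Generically (K := ℂ) (σ := Fin n × Fin 3 × Fin 3) fun cpar =>
      ∀ i j, i ≠ j → ∀ s t, (∀ i, IsUnit (chartOf cpar i).det) →
        ∀ y ∈ isoLine (A i) (chartOf cpar i) s, y ∈ isoLine (A j) (chartOf cpar j) t → y = 0 := by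
    refine generically_forall fun i => generically_forall fun j => generically_imp fun hij =>
      generically_forall fun s => generically_forall fun t => ?_
    classical
    obtain ⟨x, hx⟩ := exists_notMem_span (F := {c i, c j})
      (Finset.card_le_two.trans_lt (by norm_num))
    obtain ⟨x', hx'⟩ := exists_notMem_span (F := {c i, c j, x})
      (Finset.card_le_three.trans_lt (by norm_num))
    have hAx : (A i).mulVec x ≠ 0 := fun h => hx (by
      obtain ⟨t, rfl⟩ := hspan i x h
      exact Submodule.smul_mem _ _ (Submodule.subset_span (by simp)))
    have hAx' : (A j).mulVec x' ≠ 0 := fun h => hx' (by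
      obtain ⟨t, rfl⟩ := hspan j x' h
      exact Submodule.smul_mem _ _ (Submodule.subset_span (by simp)))
    obtain ⟨C, hCd, hC⟩ := exists_chart_isoVec hAx s
    obtain ⟨C', hCd', hC'⟩ := exists_chart_isoVec hAx' t
    refine (generically_ker_eq_bot (polyFam_planeForm (A := A) i) (polyFam_isoForm (A := A) i s)
      (polyFam_planeForm (A := A) j) (polyFam_isoForm (A := A) j t)
      (par fun m => if m = i then C else C') ?_).mono ?_
    · intro y h1 h2 h3 h4
      simp only [hpar, if_true, hij.symm, if_false] at h1 h2 h3 h4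
      obtain ⟨a, b, hab⟩ := eq_of_mem_isoLine (hspan i) hC
        ((isoForm_eq_zero_iff hCd).mp (Prod.ext h1 h2))
      obtain ⟨a', b', hab'⟩ := eq_of_mem_isoLine (hspan j) hC'
        ((isoForm_eq_zero_iff hCd').mp (Prod.ext h3 h4))
      have hb' : b' = 0 := by
        by_contra hb
        refine hx' ?_
        have : x' = (b'⁻¹ * a) • c i + (-(b'⁻¹ * a')) • c j + (b'⁻¹ * b) • x := by
          have h5 : b' • x' = a • c i + b • x - a' • c j := by rw [← hab, hab']; module
          have h6 : x' = b'⁻¹ • (b' • x') := by rw [smul_smul, inv_mul_cancel₀ hb, one_smul]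
          rw [h6, h5]
          module
        rw [this]
        refine add_mem (add_mem ?_ ?_) ?_ <;>
          exact Submodule.smul_mem _ _ (Submodule.subset_span (by simp))
      have hb : b = 0 := by
        by_contra hb
        refine hx ?_
        have : x = (-(b⁻¹ * a)) • c i + (b⁻¹ * a') • c j := by
          have h5 : b • x = a' • c j - a • c i := by
            rw [hb', zero_smul, add_zero] at hab'
            rw [← hab', hab]; module
          have h6 : x = b⁻¹ • (b • x) := by rw [smul_smul, inv_mul_cancel₀ hb, one_smul]
          rw [h6, h5]
          module
        rw [this]
        refine add_mem ?_ ?_ <;>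
          exact Submodule.smul_mem _ _ (Submodule.subset_span (by simp))
      refine h0 i j hij y ?_ ?_
      · rw [hab, hb, zero_smul, add_zero, Matrix.mulVec_smul, hAc, smul_zero]
      · rw [hab', hb', zero_smul, add_zero, Matrix.mulVec_smul, hAc, smul_zero]
    · intro cpar H hdet y hy hy'
      rw [← isoForm_eq_zero_iff (hdet _)] at hy hy'
      exact H y (congrArg Prod.fst hy) (congrArg Prod.snd hy) (congrArg Prod.fst hy')
        (congrArg Prod.snd hy')
  have g3 : Generically (K := ℂ) (σ := Fin n × Fin 3 × Fin 3) fun cpar =>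
      ∀ i j k l, i ≠ j → i ≠ k → i ≠ l → j ≠ k → j ≠ l → k ≠ l → ∀ y,
        planeForm (A i) (chartOf cpar i) y = 0 → planeForm (A j) (chartOf cpar j) y = 0 →
        planeForm (A k) (chartOf cpar k) y = 0 → planeForm (A l) (chartOf cpar l) y = 0 →
        y = 0 := by
    refine generically_forall fun i => generically_forall fun j => generically_forall fun k =>
      generically_forall fun l => generically_imp fun hij => generically_imp fun hik =>
      generically_imp fun hil => generically_imp fun hjk => generically_imp fun hjl =>
      generically_imp fun hkl => ?_
    obtain ⟨hi, hj, hk, hii, hjj, hkk, hi0, hj0, hk0, z, hz, hw⟩ := exists_three_forms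
      (ck := c k) (hind l i hil.symm) (hind i j hij)
    obtain ⟨hl, hlz, hll⟩ := exists_dual_of_ne_smul hz
    obtain ⟨Ci, hCi⟩ := hreal i hi hi0 hii
    obtain ⟨Cj, hCj⟩ := hreal j hj hj0 hjj
    obtain ⟨Ck, hCk⟩ := hreal k hk hk0 hkk
    obtain ⟨Cl, hCl⟩ := hreal l hl (by rintro rfl; simp at hlz) hll
    refine generically_ker_eq_bot (polyFam_planeForm (A := A) i) (polyFam_planeForm (A := A) j)
      (polyFam_planeForm (A := A) k) (polyFam_planeForm (A := A) l)
      (par fun m => if m = i then Ci else if m = j then Cj else if m = k then Ck else Cl) ?_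
    intro y h1 h2 h3 h4
    simp only [hpar, if_true, hij.symm, hik.symm, hil.symm, hjk.symm, hjl.symm, hkl.symm, if_false,
      hCi, hCj, hCk, hCl] at h1 h2 h3 h4
    obtain ⟨s, rfl⟩ := hw y h1 h2 h3
    rw [map_smul, smul_eq_mul] at h4
    rw [(mul_eq_zero.mp h4).resolve_right hlz, zero_smul]
  have g3' : Generically (K := ℂ) (σ := Fin n × Fin 3 × Fin 3) fun cpar =>
      ∀ i j k, i ≠ j → i ≠ k → j ≠ k → ∃ g : (Fin 4 → ℂ) →ₗ[ℂ] ℂ, ∀ y,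
        planeForm (A i) (chartOf cpar i) y = 0 → planeForm (A j) (chartOf cpar j) y = 0 →
        planeForm (A k) (chartOf cpar k) y = 0 → g y = 0 → y = 0 := by
    refine generically_forall fun i => generically_forall fun j => generically_forall fun k =>
      generically_imp fun hij => generically_imp fun hik => generically_imp fun hjk => ?_
    obtain ⟨hi, hj, hk, hii, hjj, hkk, hi0, hj0, hk0, z, hz, hw⟩ := exists_three_forms
      (ck := c k) (hind j i hij.symm) (hind i j hij)
    obtain ⟨g, hgz, -⟩ := exists_dual_of_ne_smul hz
    obtain ⟨Ci, hCi⟩ := hreal i hi hi0 hii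
    obtain ⟨Cj, hCj⟩ := hreal j hj hj0 hjj
    obtain ⟨Ck, hCk⟩ := hreal k hk hk0 hkk
    refine (generically_ker_eq_bot (polyFam_planeForm (A := A) i) (polyFam_planeForm (A := A) j)
      (polyFam_planeForm (A := A) k) (polyFam_const g)
      (par fun m => if m = i then Ci else if m = j then Cj else Ck) ?_).mono
      fun _ H => ⟨g, H⟩
    intro y h1 h2 h3 h4
    simp only [hpar, if_true, hij.symm, hik.symm, hjk.symm, if_false, hCi, hCj, hCk] at h1 h2 h3
    obtain ⟨s, rfl⟩ := hw y h1 h2 h3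
    rw [map_smul, smul_eq_mul] at h4
    rw [(mul_eq_zero.mp h4).resolve_right hgz, zero_smul]
  have g4 : Generically (K := ℂ) (σ := Fin n × Fin 3 × Fin 3) fun cpar =>
      ∀ i j k, i ≠ j → i ≠ k → j ≠ k → ∀ s, (∀ i, IsUnit (chartOf cpar i).det) →
        ∀ y ∈ isoLine (A i) (chartOf cpar i) s, planeForm (A j) (chartOf cpar j) y = 0 →
        planeForm (A k) (chartOf cpar k) y = 0 → y = 0 := by
    refine generically_forall fun i => generically_forall fun j => generically_forall fun k =>
      generically_imp fun hij => generically_imp fun hik => generically_imp fun hjk =>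
      generically_forall fun s => ?_
    classical
    obtain ⟨hj, hji, hjj⟩ := exists_dual_of_ne_smul (hind i j hij)
    obtain ⟨x, hx⟩ := exists_notMem_span (F := {c i, c k})
      (Finset.card_le_two.trans_lt (by norm_num))
    obtain ⟨hk, hkx, hkS⟩ := exists_dual_ne_zero hx
    have hki : hk (c i) = 0 := hkS _ (Submodule.subset_span (by simp))
    have hkk : hk (c k) = 0 := hkS _ (Submodule.subset_span (by simp))
    have hAx : (A i).mulVec x ≠ 0 := fun h => hx (by
      obtain ⟨t, rfl⟩ := hspan i x h
      exact Submodule.smul_mem _ _ (Submodule.subset_span (by simp)))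
    obtain ⟨Ci, hCd, hC⟩ := exists_chart_isoVec hAx s
    obtain ⟨Cj, hCj⟩ := hreal j hj (by rintro rfl; simp at hji) hjj
    obtain ⟨Ck, hCk⟩ := hreal k hk (by rintro rfl; simp at hkx) hkk
    refine (generically_ker_eq_bot (polyFam_planeForm (A := A) i) (polyFam_isoForm (A := A) i s)
      (polyFam_planeForm (A := A) j) (polyFam_planeForm (A := A) k)
      (par fun m => if m = i then Ci else if m = j then Cj else Ck) ?_).mono ?_
    · intro y h1 h2 h3 h4
      simp only [hpar, if_true, hij.symm, hik.symm, hjk.symm, if_false, hCj, hCk] at h1 h2 h3 h4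
      obtain ⟨a, b, rfl⟩ := eq_of_mem_isoLine (hspan i) hC
        ((isoForm_eq_zero_iff hCd).mp (Prod.ext h1 h2))
      simp only [map_add, map_smul, hki, smul_eq_mul, mul_zero, zero_add] at h4
      have hb := (mul_eq_zero.mp h4).resolve_right hkx
      simp only [map_add, map_smul, hb, smul_eq_mul, zero_mul, add_zero] at h3
      rw [(mul_eq_zero.mp h3).resolve_right hji, hb, zero_smul, zero_smul, add_zero]
    · intro cpar H hdet y hy hj hk
      rw [← isoForm_eq_zero_iff (hdet _)] at hy
      exact H y (congrArg Prod.fst hy) (congrArg Prod.snd hy) hj hk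
  refine ((((g1.and g2).and g3).and g3').and g4).mono ?_
  rintro cpar ⟨⟨⟨⟨G1, G2⟩, G3⟩, G3'⟩, G4⟩ hdet
  refine ⟨hdet, hA, G1, fun i j hij s t => G2 i j hij s t hdet, G3, ?_,
    fun i j k hij hik hjk s => G4 i j k hij hik hjk s hdet⟩
  intro i j k hij hik hjk y y' hy h1 h2 h3 h1' h2' h3'
  obtain ⟨g, hg⟩ := G3' i j k hij hik hjk
  have hgy : g y ≠ 0 := fun h => hy (hg y h1 h2 h3 h)
  refine ⟨g y' / g y, sub_eq_zero.mp (hg _ ?_ ?_ ?_ ?_)⟩ <;> simp [h1, h2, h3, h1', h2', h3', hgy]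

end Witnesses

theorem mulVec_surjective_of_rank {Am : Matrix (Fin 3) (Fin 4) ℂ} (h : Am.rank = 3) :
    Function.Surjective Am.mulVec := by
  have : LinearMap.range Am.mulVecLin = ⊤ :=
    Submodule.eq_top_of_finrank_eq (by simpa [Matrix.rank] using h)
  exact LinearMap.range_eq_top.mp this

end

/-- **Theorem 4.2 (4).** For `n ≥ 3` general cameras, general affine charts and a
general `β ∈ ℂ²ⁿ⁺¹`, `χ(D_Q ∩ D_∞) = -n³/3 + 13n/3`, i.e.
`3 χ(D_Q ∩ D_∞) = -n³ + 13n`. -/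
theorem chi_DQ_inter_Dinf (n : ℕ) (hn : 3 ≤ n) :
    Generically (K := ℂ) (σ := Fin n × Fin 3 × Fin 4) fun a =>
      (∀ i, (camOfC a i).rank = 3) →
      Generically (K := ℂ) (σ := Fin n × Fin 3 × Fin 3) fun cpar =>
        (∀ i, IsUnit (chartOf cpar i).det) →
        Generically (K := ℂ) (σ := Fin (2 * n + 1)) fun β =>
          ∃ e : ℤ,
            HasEulerChar
              ↥(DQ (camOfC a) (chartOf cpar) β ∩ DinfAll (camOfC a) (chartOf cpar)) e ∧
            3 * e = -(n : ℤ) ^ 3 + 13 * (n : ℤ) :=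
  (generically_centers n).mono fun _ h0 hrank =>
    (generically_goodConfig (fun i => mulVec_surjective_of_rank (hrank i)) h0).mono
      fun _ hG hdet => generically_of_forall fun β => (hG hdet).hasEulerChar (by omega) β

end PaperED
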